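/- Any classical algorithm for the glued-trees traversal problem that makes at most 2^{n/6} queries to the oracle finds the EXIT with probability at most 4 · 2^{−n/6}, where the probability is over the random graph G_n', the uniformly random assignment of distinct 2n-bit names to vertices (with ENTRANCE named 0), and the random 9-coloring of edges. -/

import Mathlib

attribute [local instance] Classical.propDecidable

namespace GluedTreesLowerBound

/-- Vertices of the glued-trees graph `G_n'`: a side bit (`false` = left tree,
`true` = right tree), a depth `j ≤ n`, and a path of `j` bits from the root of that
tree.  Depth-`n` vertices on the two sides are the leaves joined by the random
alternating cycle. -/
abbrev Vertex (n : ℕ) := Bool × Σ j : Fin (n + 1), (Fin j.val → Bool)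

/-- The depth of a vertex within its own tree. -/
def depth {n : ℕ} (u : Vertex n) : ℕ := u.2.1.val

/-- The ENTRANCE: root of the left tree. -/
def entrance (n : ℕ) : Vertex n := (false, ⟨⟨0, Nat.succ_pos n⟩, fun i => i.elim0⟩)

/-- The EXIT: root of the right tree. -/
def exitVertex (n : ℕ) : Vertex n := (true, ⟨⟨0, Nat.succ_pos n⟩, fun i => i.elim0⟩)

/-- The column of a vertex, `0 ≤ col ≤ 2n+1`. -/
def col {n : ℕ} (u : Vertex n) : ℕ := if u.1 = false then depth u else 2 * n + 1 - depth u

/-- `v` is a child of `u` (one level deeper in the same tree, extending its path). -/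
def childOf {n : ℕ} (v u : Vertex n) : Prop :=
  v.1 = u.1 ∧ ∃ h : v.2.1.val = u.2.1.val + 1,
    ∀ i : Fin u.2.1.val, v.2.2 (Fin.castLE (by omega) i) = u.2.2 i

/-- The path of a leaf, as a function `Fin n → Bool` (junk values below a leaf). -/
def leafPath {n : ℕ} (u : Vertex n) : Fin n → Bool :=
  fun i => if h : i.val < depth u then u.2.2 ⟨i.val, h⟩ else false

/-- The random alternating cycle, parametrized by two bijections `σ, τ` from
`Fin 2^n` to the set of leaf paths: the cycle visits
left `σ 0`, right `τ 0`, left `σ 1`, right `τ 1`, …, closing up cyclically.  So the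
left leaf `σ i` is joined to the right leaves `τ i` and `τ (i−1)`. -/
def cycleAdj {n : ℕ} (σ τ : Fin (2 ^ n) ≃ (Fin n → Bool)) (u v : Vertex n) : Prop :=
  u.1 = false ∧ v.1 = true ∧ depth u = n ∧ depth v = n ∧
    ∃ i : Fin (2 ^ n), σ i = leafPath u ∧ (τ i = leafPath v ∨ τ (i - 1) = leafPath v)

/-- Adjacency in `G_n'`: tree edges plus the random alternating cycle. -/
def adj {n : ℕ} (σ τ : Fin (2 ^ n) ≃ (Fin n → Bool)) (u v : Vertex n) : Prop :=
  childOf u v ∨ childOf v u ∨ cycleAdj σ τ u v ∨ cycleAdj σ τ v u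

/-- A canonical local slot (in `Fin 3`) of the edge towards `v`, among the at most
three edges incident to `u`:  the parent edge gets slot `0`, the two child (or cycle)
edges get slots `1` and `2`. -/
def slot {n : ℕ} (σ τ : Fin (2 ^ n) ≃ (Fin n → Bool)) (u v : Vertex n) : Fin 3 :=
  if u.1 = v.1 then
    if h : depth u < depth v then (if v.2.2 ⟨depth u, h⟩ then 2 else 1) else 0
  else if u.1 = false then
    (if τ (σ.symm (leafPath u)) = leafPath v then 1 else 2)
  else
    (if σ (τ.symm (leafPath u)) = leafPath v then 1 else 2)

/-- The random `9 = 3 × 3` coloring of the edge `{u,v}`: each vertex `w` carries a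
random permutation `ρ w` of its three local slots; an edge between an even column and
an odd column is colored by the pair (label at its even endpoint, label at its odd
endpoint). -/
def ecolor {n : ℕ} (σ τ : Fin (2 ^ n) ≃ (Fin n → Bool))
    (ρ : Vertex n → Equiv.Perm (Fin 3)) (u v : Vertex n) : Fin 3 × Fin 3 :=
  if col u % 2 = 0 then (ρ u (slot σ τ u v), ρ v (slot σ τ v u))
  else (ρ v (slot σ τ v u), ρ u (slot σ τ u v))

/-- Vertex names: `2n`-bit strings. -/
abbrev Names (n : ℕ) := Fin (2 * n) → Bool

/-- The random data defining an oracle instance: the two bijections defining the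
random alternating cycle, the random slot-permutations defining the random
`9`-coloring, and the random injective naming of vertices by `2n`-bit strings, with
the ENTRANCE named `0…0`.  The uniform distribution over `Param n` is the
distribution of oracles in the traversal problem. -/
abbrev Param (n : ℕ) :=
  ((Fin (2 ^ n) ≃ (Fin n → Bool)) × (Fin (2 ^ n) ≃ (Fin n → Bool)))
    × (Vertex n → Equiv.Perm (Fin 3))
    × {ν : Vertex n ↪ Names n // ν (entrance n) = fun _ => false}

/-- The oracle's answer to the query string `q`: if `q` names a vertex, the set of
(name, edge color) pairs of its neighbors; otherwise `none`. -/
noncomputable def answer {n : ℕ} (P : Param n) (q : Names n) :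
    Option (Finset (Names n × (Fin 3 × Fin 3))) :=
  if h : ∃ u : Vertex n, P.2.2.1 u = q then
    some ((Finset.univ.filter fun w => adj P.1.1 P.1.2 (Classical.choose h) w).image
      fun w => (P.2.2.1 w, ecolor P.1.1 P.1.2 P.2.1 (Classical.choose h) w))
  else none

/-- A deterministic adaptive classical algorithm: given the transcript of previous
(query, answer) pairs, produce the next query. -/
abbrev Strategy (n : ℕ) :=
  List (Names n × Option (Finset (Names n × (Fin 3 × Fin 3)))) → Names n

/-- The transcript of the first `k` (query, answer) pairs of strategy `A` against the
oracle instance `P`. -/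
noncomputable def transcript {n : ℕ} (P : Param n) (A : Strategy n) :
    ℕ → List (Names n × Option (Finset (Names n × (Fin 3 × Fin 3))))
  | 0 => []
  | k + 1 => transcript P A k
      ++ [(A (transcript P A k), answer P (A (transcript P A k)))]

/-- The algorithm wins if one of its first `q` queries is the name of the EXIT. -/
def Wins {n : ℕ} (P : Param n) (A : Strategy n) (q : ℕ) : Prop :=
  ∃ k < q, A (transcript P A k) = P.2.2.1 (exitVertex n)

/-! ### The glued trees with leaves named by their position on the cycle -/

/-- Root-last addresses of leaves. -/
abbrev Leaf (n : ℕ) := {p : List Bool // p.length = n}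

/-- Vertices with leaves named by their position on the alternating cycle: a side bit together
with the root-last address of an internal vertex or the cycle index of a leaf. -/
abbrev Node (n : ℕ) := Bool × ({p : List Bool // p.length < n} ⊕ Fin (2 ^ n))

/-- For each side, the leaf attached to each cycle index. -/
abbrev Attach (n : ℕ) := Bool → (Fin (2 ^ n) ≃ Leaf n)

/-- The slot of the child with the given last bit. -/
def bitSlot (b : Bool) : Fin 3 := bif b then 2 else 1

variable {n : ℕ}

/-- The tree address of a node. -/
def addr (α : Attach n) (u : Node n) : List Bool :=
  match u with
  | (_, .inl p) => p.1
  | (s, .inr i) => (α s i).1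

/-- The node with a given side and tree address (junk for addresses that are too long). -/
def nodeAt (α : Attach n) (s : Bool) (p : List Bool) : Node n :=
  if h : p.length < n then (s, .inl ⟨p, h⟩)
  else if h : p.length = n then (s, .inr ((α s).symm ⟨p, h⟩)) else (s, .inr 0)

/-- The root on a given side. -/
def root (n : ℕ) (s : Bool) : Node n :=
  if h : 0 < n then (s, .inl ⟨[], h⟩) else (s, .inr 0)

/-- Nodes lying on the cycle. -/
def OnCycle (u : Node n) : Prop := u.2.isRight = true

/-- The cycle neighbor of the leaf with index `i` through slot `1` or `2`. -/
def crossIndex (s : Bool) (j : Fin 3) (i : Fin (2 ^ n)) : Fin (2 ^ n) :=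
  if j = 1 then i else bif s then i + 1 else i - 1

/-- The neighbor of `u` through slot `j`, together with the slot leading back. -/
def move (α : Attach n) (u : Node n) (j : Fin 3) : Node n × Fin 3 :=
  if j = 0 then
    match addr α u with
    | [] => (u, 0)
    | b :: p => (nodeAt α u.1 p, bitSlot b)
  else
    match u with
    | (s, .inl p) => (nodeAt α s ((j == 2) :: p.1), 0)
    | (s, .inr i) => ((!s, .inr (crossIndex s j i)), j)

/-- The slot difference for the turn `d` at a vertex of orientation `e`. -/
def turn (e d : Bool) : Fin 3 := bif e then bitSlot d else -bitSlot d

/-- The non-backtracking walk from the left root that takes the turns in a word (last turn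
first), together with the slot through which it could backtrack. -/
def walk (α : Attach n) (ε : Node n → Bool) : List Bool → Node n × Fin 3
  | [] => (root n false, 0)
  | d :: w => move α (walk α ε w).1 ((walk α ε w).2 + turn (ε (walk α ε w).1) d)

/-- The end vertex of a walk. -/
def pos (α : Attach n) (ε : Node n → Bool) (w : List Bool) : Node n := (walk α ε w).1

/-- The slot leading back at the end of a walk. -/
def back (α : Attach n) (ε : Node n → Bool) (w : List Bool) : Fin 3 := (walk α ε w).2

/-- The slot used by the last step of the walk with word `d :: w`. -/
def outSlot (α : Attach n) (ε : Node n → Bool) (w : List Bool) (d : Bool) : Fin 3 :=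
  back α ε w + turn (ε (pos α ε w)) d

lemma walk_cons (α : Attach n) (ε : Node n → Bool) (d : Bool) (w : List Bool) :
    walk α ε (d :: w) = move α (pos α ε w) (outSlot α ε w d) := rfl

lemma pos_cons (α : Attach n) (ε : Node n → Bool) (d : Bool) (w : List Bool) :
    pos α ε (d :: w) = (move α (pos α ε w) (outSlot α ε w d)).1 := rfl

lemma back_cons (α : Attach n) (ε : Node n → Bool) (d : Bool) (w : List Bool) :
    back α ε (d :: w) = (move α (pos α ε w) (outSlot α ε w d)).2 := rfl

lemma turn_ne_zero (e d : Bool) : turn e d ≠ 0 := by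
  revert e d; decide

lemma outSlot_ne_back (α : Attach n) (ε : Node n → Bool) (w : List Bool) (d : Bool) :
    outSlot α ε w d ≠ back α ε w := by
  unfold outSlot
  intro h
  exact turn_ne_zero _ _ (by simpa using h)

lemma turn_injective (e : Bool) : Function.Injective (turn e) := by
  revert e; decide

lemma outSlot_injective (α : Attach n) (ε : Node n → Bool) (w : List Bool) :
    Function.Injective (outSlot α ε w) := fun _ _ h =>
  turn_injective _ (add_left_cancel (a := back α ε w) h)

lemma bitSlot_ne_zero (b : Bool) : bitSlot b ≠ 0 := by revert b; decide

lemma bitSlot_beq_two (b : Bool) : (bitSlot b == 2) = b := by revert b; decide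

lemma bitSlot_of_ne_zero (j : Fin 3) (h : j ≠ 0) : bitSlot (j == 2) = j := by
  revert j; decide

@[simp] lemma fst_nodeAt (α : Attach n) (s : Bool) (p : List Bool) : (nodeAt α s p).1 = s := by
  unfold nodeAt; split_ifs <;> rfl

lemma addr_nodeAt (α : Attach n) (s : Bool) {p : List Bool} (h : p.length ≤ n) :
    addr α (nodeAt α s p) = p := by
  unfold nodeAt
  split_ifs with h1 h2
  · rfl
  · simp [addr]
  · omega

lemma nodeAt_addr (α : Attach n) (u : Node n) : nodeAt α u.1 (addr α u) = u := by
  obtain ⟨s, p | i⟩ := u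
  · simp [nodeAt, addr, p.2]
  · simp [nodeAt, addr, (α s i).2]

lemma node_ext (α : Attach n) {u v : Node n} (h : u.1 = v.1) (h' : addr α u = addr α v) :
    u = v := by
  rw [← nodeAt_addr α u, ← nodeAt_addr α v, h, h']

lemma length_addr_le (α : Attach n) (u : Node n) : (addr α u).length ≤ n := by
  obtain ⟨s, p | i⟩ := u
  · exact p.2.le
  · exact (α s i).2.le

lemma onCycle_iff (α : Attach n) (u : Node n) : OnCycle u ↔ (addr α u).length = n := by
  obtain ⟨s, p | i⟩ := u
  · simp [OnCycle, addr, p.2.ne]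
  · simp [OnCycle, addr, (α s i).2]

lemma not_onCycle_iff (α : Attach n) (u : Node n) : ¬ OnCycle u ↔ (addr α u).length < n := by
  rw [onCycle_iff α]; have := length_addr_le α u; omega

@[simp] lemma root_fst (s : Bool) : (root n s).1 = s := by
  unfold root; split_ifs <;> rfl

lemma addr_root (hn : 0 < n) (α : Attach n) (s : Bool) : addr α (root n s) = [] := by
  simp [root, hn, addr]

lemma eq_root_iff (hn : 0 < n) (α : Attach n) (u : Node n) : u = root n u.1 ↔ addr α u = [] := by
  constructor
  · intro h; rw [h, addr_root hn]
  · intro h; exact node_ext α (by simp) (by rw [h, addr_root hn])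

lemma move_zero (α : Attach n) {u : Node n} {b : Bool} {p : List Bool} (h : addr α u = b :: p) :
    move α u 0 = (nodeAt α u.1 p, bitSlot b) := by
  simp [move, h]

lemma move_down (α : Attach n) {u : Node n} (hu : ¬ OnCycle u) {j : Fin 3} (hj : j ≠ 0) :
    move α u j = (nodeAt α u.1 ((j == 2) :: addr α u), 0) := by
  obtain ⟨s, p | i⟩ := u
  · simp [move, hj, addr]
  · simp [OnCycle] at hu

lemma move_cross (α : Attach n) (s : Bool) (i : Fin (2 ^ n)) {j : Fin 3} (hj : j ≠ 0) :
    move α (s, .inr i) j = ((!s, .inr (crossIndex s j i)), j) := by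
  simp [move, hj]

lemma crossIndex_crossIndex (s : Bool) (j : Fin 3) (i : Fin (2 ^ n)) :
    crossIndex (!s) j (crossIndex s j i) = i := by
  unfold crossIndex
  split_ifs
  · rfl
  · cases s <;> simp

lemma move_move (α : Attach n) (u : Node n) (j : Fin 3) (h : addr α u ≠ [] ∨ j ≠ 0) :
    move α (move α u j).1 (move α u j).2 = (u, j) := by
  by_cases hj : j = 0
  · subst hj
    obtain ⟨b, p, hp⟩ := List.exists_cons_of_ne_nil (h.resolve_right (by simp))
    have hl := length_addr_le α u
    rw [hp, List.length_cons] at hl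
    have hc : ¬ OnCycle (nodeAt α u.1 p) := by
      rw [not_onCycle_iff α, addr_nodeAt α _ (by omega)]; omega
    rw [move_zero α hp]
    simp only
    rw [move_down α hc (bitSlot_ne_zero b), addr_nodeAt α _ (by omega), bitSlot_beq_two, fst_nodeAt,
      ← hp, nodeAt_addr]
  · by_cases hc : OnCycle u
    · obtain ⟨s, p | i⟩ := u
      · simp [OnCycle] at hc
      · rw [move_cross α s i hj]
        simp only
        rw [move_cross α _ _ hj, crossIndex_crossIndex, Bool.not_not]
    · rw [move_down α hc hj]
      simp only
      have hl := (not_onCycle_iff α u).1 hc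
      rw [move_zero α (addr_nodeAt α _ (by simpa using hl)), fst_nodeAt, nodeAt_addr,
        bitSlot_of_ne_zero _ hj]

/-! ### Invariants of non-backtracking walks -/

/-- The word at which the current excursion from the cycle into a tree began. -/
noncomputable def base (α : Attach n) (ε : Node n → Bool) : List Bool → Option (List Bool)
  | [] => none
  | d :: w => if OnCycle (pos α ε w) ∧ ¬ OnCycle (pos α ε (d :: w)) then some w else base α ε w

/-- The word `w` ends at a leaf that was reached from inside its tree. -/
def TreeLeaf (α : Attach n) (ε : Node n → Bool) (w : List Bool) : Prop :=
  OnCycle (pos α ε w) ∧ back α ε w = 0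

/-- The position of a leaf on the cycle of length `2 ^ (n + 1)`. -/
def cyclePos (u : Bool × Fin (2 ^ n)) : ZMod (2 * 2 ^ n) :=
  2 * (u.2.val : ZMod (2 * 2 ^ n)) + (bif u.1 then 1 else 0)

/-- The cycle position of a node (zero for internal vertices). -/
def nodePos (u : Node n) : ZMod (2 * 2 ^ n) :=
  match u with
  | (_, .inl _) => 0
  | (s, .inr i) => cyclePos (s, i)

/-- The direction along the cycle when leaving side `s` through slot `j`. -/
def dir (s : Bool) (j : Fin 3) : ℤ := if (s = false ↔ j = 1) then 1 else -1

lemma dir_not {s : Bool} {j j' : Fin 3} (h : j ≠ 0) (h' : j' ≠ 0) (hne : j' ≠ j) :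
    dir (!s) j = dir s j' := by
  cases s <;> fin_cases j <;> fin_cases j' <;> simp_all [dir]

/-- The last `m` letters of an address. -/
def stem (m : ℕ) (p : List Bool) : List Bool := p.drop (p.length - m)

/-- No climb reaches depth `m`, distinct excursions have distinct stems, and the leaves entered
from inside a tree are pairwise more than `K` apart on the cycle. -/
structure Good (m K : ℕ) (α : Attach n) (ε : Node n → Bool) (T : Finset (List Bool)) : Prop where
  noClimb : ∀ w ∈ T, back α ε w ≠ 0 → ¬ OnCycle (pos α ε w) → m < (addr α (pos α ε w)).length
  stem_sep : ∀ w₁ ∈ T, ∀ w₂ ∈ T, ¬ OnCycle (pos α ε w₁) → ¬ OnCycle (pos α ε w₂) →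
    (pos α ε w₁).1 = (pos α ε w₂).1 → m ≤ (addr α (pos α ε w₁)).length →
    m ≤ (addr α (pos α ε w₂)).length →
    stem m (addr α (pos α ε w₁)) = stem m (addr α (pos α ε w₂)) → base α ε w₁ = base α ε w₂
  leaf_sep : ∀ t₁ ∈ T, ∀ t₂ ∈ T, t₁ ≠ t₂ → TreeLeaf α ε t₁ → TreeLeaf α ε t₂ →
    ∀ z : ℤ, z.natAbs ≤ K → nodePos (pos α ε t₁) ≠ nodePos (pos α ε t₂) + z

/-- Suffix-closed sets of words containing the empty word. -/
structure SuffixClosed (T : Finset (List Bool)) : Prop where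
  nil_mem : [] ∈ T
  tail_mem : ∀ d w, d :: w ∈ T → w ∈ T

lemma SuffixClosed.mem {T : Finset (List Bool)} (hT : SuffixClosed T) {v : List Bool} :
    ∀ {w : List Bool}, w ∈ T → v <:+ w → v ∈ T
  | [], hw, h => by rw [List.suffix_nil] at h; rwa [h]
  | d :: w, hw, h => by
    rcases List.suffix_cons_iff.1 h with h | h
    · rwa [h]
    · exact hT.mem (hT.tail_mem d w hw) h

lemma stem_cons {m : ℕ} {p : List Bool} (h : m ≤ p.length) (b : Bool) :
    stem m (b :: p) = stem m p := by
  unfold stem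
  rw [List.length_cons, show p.length + 1 - m = (p.length - m) + 1 by omega, List.drop_succ_cons]

section
variable (α : Attach n) (ε : Node n → Bool)

lemma pos_nil : pos α ε [] = root n false := rfl

lemma back_nil : back α ε [] = 0 := rfl

variable {α ε}

/-- A step into the parent. -/
lemma step_up {w : List Bool} {d b : Bool} {p : List Bool} (h0 : outSlot α ε w d = 0)
    (hp : addr α (pos α ε w) = b :: p) :
    pos α ε (d :: w) = nodeAt α (pos α ε w).1 p ∧ back α ε (d :: w) = bitSlot b ∧
      addr α (pos α ε (d :: w)) = p ∧ (pos α ε (d :: w)).1 = (pos α ε w).1 ∧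
      ¬ OnCycle (pos α ε (d :: w)) := by
  have hl := length_addr_le α (pos α ε w)
  rw [hp, List.length_cons] at hl
  have h := move_zero α hp
  rw [← h0] at h
  have h1 : pos α ε (d :: w) = nodeAt α (pos α ε w).1 p := by rw [pos_cons, h]
  have h2 : addr α (pos α ε (d :: w)) = p := by rw [h1, addr_nodeAt α _ (by omega)]
  refine ⟨h1, by rw [back_cons, h], h2, by rw [h1, fst_nodeAt], ?_⟩
  rw [not_onCycle_iff α, h2]; omega

/-- A step into a child. -/
lemma step_down {w : List Bool} {d : Bool} (h0 : outSlot α ε w d ≠ 0)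
    (hc : ¬ OnCycle (pos α ε w)) :
    back α ε (d :: w) = 0 ∧
      addr α (pos α ε (d :: w)) = (outSlot α ε w d == 2) :: addr α (pos α ε w) ∧
      (pos α ε (d :: w)).1 = (pos α ε w).1 := by
  have hl := (not_onCycle_iff α _).1 hc
  have h := move_down α hc h0
  refine ⟨by rw [back_cons, h], ?_, by rw [pos_cons, h, fst_nodeAt]⟩
  rw [pos_cons, h, addr_nodeAt]
  simpa using hl

/-- A step along the cycle. -/
lemma step_cross {w : List Bool} {d : Bool} (h0 : outSlot α ε w d ≠ 0)
    (hc : OnCycle (pos α ε w)) :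
    back α ε (d :: w) = outSlot α ε w d ∧ OnCycle (pos α ε (d :: w)) ∧
      (pos α ε (d :: w)).1 = !(pos α ε w).1 ∧
      nodePos (pos α ε (d :: w)) = nodePos (pos α ε w) + dir (pos α ε w).1 (outSlot α ε w d) := by
  rw [back_cons, pos_cons]
  generalize outSlot α ε w d = j at *
  generalize pos α ε w = u at *
  obtain ⟨s, p | i⟩ := u
  · simp [OnCycle] at hc
  rw [move_cross α s i h0]
  refine ⟨rfl, rfl, rfl, ?_⟩
  have key : ∀ i : Fin (2 ^ n), (2 * ((i + 1 : Fin (2 ^ n)).val : ZMod (2 * 2 ^ n)))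
      = 2 * (i.val : ZMod (2 * 2 ^ n)) + 2 := by
    intro i
    have h : 2 * (i + 1 : Fin (2 ^ n)).val ≡ 2 * (i.val + 1) [MOD 2 * 2 ^ n] := by
      apply Nat.ModEq.mul_left'
      rw [Fin.val_add, Nat.ModEq, Nat.mod_mod, Fin.coe_ofNat_eq_mod, Nat.add_mod_mod]
    have := (ZMod.natCast_eq_natCast_iff _ _ _).2 h
    push_cast at this
    rw [this]; ring
  have key' : (2 * ((i - 1 : Fin (2 ^ n)).val : ZMod (2 * 2 ^ n)))
      = 2 * (i.val : ZMod (2 * 2 ^ n)) - 2 := by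
    have := key (i - 1)
    rw [sub_add_cancel] at this
    rw [this]; ring
  by_cases hj : j = 1
  · cases s <;> simp [nodePos, cyclePos, crossIndex, dir, hj]
  · cases s <;> simp [nodePos, cyclePos, crossIndex, dir, hj, key, key']
    · ring
    · ring

lemma not_onCycle_nil (hn : 0 < n) : ¬ OnCycle (pos α ε []) := by
  rw [pos_nil, not_onCycle_iff α, addr_root hn]; simpa

/-- Every cycle word extends, monotonically along the cycle, a word entering the cycle from a
tree. -/
lemma exists_run (hn : 0 < n) : ∀ w : List Bool, OnCycle (pos α ε w) → ∃ t k, t <:+ w ∧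
    t.length + k = w.length ∧ TreeLeaf α ε t ∧ (back α ε w = 0 → k = 0) ∧
    nodePos (pos α ε w) = nodePos (pos α ε t)
      + ((dir (!(pos α ε w).1) (back α ε w) * k : ℤ) : ZMod (2 * 2 ^ n))
  | [], h => absurd h (not_onCycle_nil hn)
  | d :: w, h => by
    by_cases hb : back α ε (d :: w) = 0
    · exact ⟨d :: w, 0, List.suffix_refl _, rfl, ⟨h, hb⟩, fun _ => rfl, by simp⟩
    have h0 : outSlot α ε w d ≠ 0 := by
      intro h0
      rcases hp : addr α (pos α ε w) with _ | ⟨b, p⟩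
      · apply hb
        rw [back_cons, h0]; simp [move, hp]
      · exact (step_up h0 hp).2.2.2.2 h
    have hc : OnCycle (pos α ε w) := by
      by_contra hc
      exact hb (step_down h0 hc).1
    obtain ⟨h1, -, h3, h4⟩ := step_cross h0 hc
    obtain ⟨t, k, ht, hk, htl, hk0, hpos⟩ := exists_run hn w hc
    refine ⟨t, k + 1, ht.trans (List.suffix_cons _ _), by simp [← hk, add_assoc], htl,
      fun h => absurd h hb, ?_⟩
    rw [h4, hpos, h3, h1, Bool.not_not]
    by_cases hbw : back α ε w = 0
    · rw [hk0 hbw]; simp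
    · have hne := outSlot_ne_back α ε w d
      have : dir (!(pos α ε w).1) (back α ε w) = dir (pos α ε w).1 (outSlot α ε w d) := by
        exact dir_not hbw h0 hne
      rw [this]; push_cast; ring
end

section
variable {α : Attach n} {ε : Node n → Bool}

/-- The state of a walk that has never left its initial descent. -/
structure InDescent (α : Attach n) (ε : Node n → Bool) (w : List Bool) : Prop where
  side : (pos α ε w).1 = false
  back_eq : back α ε w = 0
  length_eq : (addr α (pos α ε w)).length = w.length

/-- The state of a walk whose last excursion into a tree started at the leaf word `b`. -/
structure InExcursion (m : ℕ) (α : Attach n) (ε : Node n → Bool) (w b : List Bool) : Prop where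
  suffix : b <:+ w
  onCycle : OnCycle (pos α ε b)
  back_ne : back α ε b ≠ 0
  side : (pos α ε w).1 = (pos α ε b).1
  le_length : m ≤ (addr α (pos α ε w)).length
  stem_eq : stem m (addr α (pos α ε w)) = stem m (addr α (pos α ε b))
  up_or_down :
    (∃ c, back α ε w = bitSlot c ∧ c :: addr α (pos α ε w) <:+ addr α (pos α ε b)) ∨
      (back α ε w = 0 ∧ ¬ addr α (pos α ε w) <:+ addr α (pos α ε b))

/-- Climbs along a word stay strictly below depth `m`. -/
def NoClimb (m : ℕ) (α : Attach n) (ε : Node n → Bool) (w : List Bool) : Prop :=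
  ∀ v, v <:+ w → back α ε v ≠ 0 → ¬ OnCycle (pos α ε v) → m < (addr α (pos α ε v)).length

lemma cons_suffix_cons_of_suffix {b c : Bool} {p L : List Bool} (hb : b :: p <:+ L)
    (hc : c :: p <:+ L) : b = c := by
  have := (List.suffix_of_suffix_length_le hb hc (by simp)).eq_of_length (by simp)
  simpa using this

lemma excursion_state {m : ℕ} (hm : 0 < m) (hmn : m < n) : ∀ w : List Bool, NoClimb m α ε w →
    ¬ (OnCycle (pos α ε w) ∧ back α ε w ≠ 0) →
    (base α ε w = none → InDescent α ε w) ∧ ∀ b, base α ε w = some b → InExcursion m α ε w b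
  | [], _, _ => by
    have hn : 0 < n := by omega
    exact ⟨fun _ => ⟨by simp [pos_nil], rfl, by simp [pos_nil, addr_root hn]⟩,
      fun b hb => by simp [base] at hb⟩
  | d :: w, hnc, htree => by
    have hnw : NoClimb m α ε w := fun v hv => hnc v (hv.trans (List.suffix_cons _ _))
    by_cases hc : OnCycle (pos α ε w)
    · by_cases h0 : outSlot α ε w d = 0
      · obtain ⟨b, p, hp⟩ : ∃ b p, addr α (pos α ε w) = b :: p := by
          rcases h : addr α (pos α ε w) with _ | ⟨b, p⟩
          · have := (onCycle_iff α _).1 hc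
            rw [h] at this; simp at this; omega
          · exact ⟨b, p, rfl⟩
        obtain ⟨-, h2, h3, h4, h5⟩ := step_up h0 hp
        have hb : base α ε (d :: w) = some w := by simp [base, hc, h5]
        have hlen := hnc _ (List.suffix_refl _) (by rw [h2]; exact bitSlot_ne_zero _) h5
        rw [h3] at hlen
        rw [hb]
        refine ⟨by simp, fun b' hb' => ?_⟩
        obtain rfl : w = b' := by simpa using hb'
        refine ⟨List.suffix_cons _ _, hc, ?_, h4, by rw [h3]; exact hlen.le, ?_, Or.inl ⟨b, h2, ?_⟩⟩
        · intro h; exact outSlot_ne_back α ε w d (h0.trans h.symm)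
        · rw [h3, hp, stem_cons hlen.le]
        · rw [h3, hp]
      · obtain ⟨h1, h2, -⟩ := step_cross h0 hc
        exact absurd ⟨h2, by rwa [h1]⟩ htree
    · obtain ⟨ih1, ih2⟩ := excursion_state hm hmn w hnw (fun h => hc h.1)
      have hb : base α ε (d :: w) = base α ε w := by simp [base, hc]
      rw [hb]
      by_cases h0 : outSlot α ε w d = 0
      · have hbk : back α ε w ≠ 0 := fun h => outSlot_ne_back α ε w d (h0.trans h.symm)
        refine ⟨fun h => absurd (ih1 h).back_eq hbk, fun b hb => ?_⟩
        have E := ih2 b hb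
        obtain ⟨c, -, hc2⟩ := E.up_or_down.resolve_right (fun h => hbk h.1)
        obtain ⟨b', p, hp⟩ : ∃ b p, addr α (pos α ε w) = b :: p := by
          rcases h : addr α (pos α ε w) with _ | ⟨b, p⟩
          · have := E.le_length
            rw [h] at this; simp at this; omega
          · exact ⟨b, p, rfl⟩
        obtain ⟨-, h2, h3, h4, h5⟩ := step_up h0 hp
        have hlen := hnc _ (List.suffix_refl _) (by rw [h2]; exact bitSlot_ne_zero _) h5
        rw [h3] at hlen
        refine ⟨E.suffix.trans (List.suffix_cons _ _), E.onCycle, E.back_ne, h4.trans E.side,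
          by rw [h3]; exact hlen.le, ?_, Or.inl ⟨b', h2, ?_⟩⟩
        · rw [← E.stem_eq, h3, hp, stem_cons hlen.le]
        · rw [h3, ← hp]
          exact (List.suffix_cons _ _).trans hc2
      · obtain ⟨h1, h2, h3⟩ := step_down h0 hc
        constructor
        · intro h
          have D := ih1 h
          exact ⟨h3.trans D.side, h1, by rw [h2]; simp [D.length_eq]⟩
        · intro b hb
          have E := ih2 b hb
          refine ⟨E.suffix.trans (List.suffix_cons _ _), E.onCycle, E.back_ne, h3.trans E.side,
            by rw [h2]; exact E.le_length.trans (by simp), ?_, Or.inr ⟨h1, ?_⟩⟩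
          · rw [h2, stem_cons E.le_length, E.stem_eq]
          · rw [h2]
            intro hs
            rcases E.up_or_down with ⟨c, hc1, hc2⟩ | ⟨-, hc2⟩
            · apply outSlot_ne_back α ε w d
              rw [hc1, ← cons_suffix_cons_of_suffix hs hc2, bitSlot_of_ne_zero _ h0]
            · exact hc2 ((List.suffix_cons _ _).trans hs)

/-- Short walks are still in their initial descent. -/
lemma short_state (hn : 0 < n) : ∀ w : List Bool, w.length < n →
    ¬ OnCycle (pos α ε w) ∧ base α ε w = none ∧ back α ε w = 0 ∧
      (addr α (pos α ε w)).length = w.length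
  | [], _ => ⟨not_onCycle_nil hn, rfl, rfl, by simp [pos_nil, addr_root hn]⟩
  | d :: w, hw => by
    obtain ⟨h1, h2, h3, h4⟩ := short_state hn w (by simp at hw; omega)
    have h0 : outSlot α ε w d ≠ 0 := by rw [← h3]; exact outSlot_ne_back α ε w d
    obtain ⟨k1, k2, k3⟩ := step_down h0 h1
    have k4 : (addr α (pos α ε (d :: w))).length = (d :: w).length := by rw [k2]; simp [h4]
    refine ⟨?_, by simp [base, h1, h2], k1, k4⟩
    rw [not_onCycle_iff α, k4]; exact hw

lemma good_of_short {m K : ℕ} (hn : 0 < n) {T : Finset (List Bool)}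
    (hT : ∀ w ∈ T, w.length < n) : Good m K α ε T where
  noClimb w hw h := absurd (short_state hn w (hT w hw)).2.2.1 h
  stem_sep w₁ h₁ w₂ h₂ _ _ _ _ _ _ := by
    rw [(short_state hn w₁ (hT _ h₁)).2.1, (short_state hn w₂ (hT _ h₂)).2.1]
  leaf_sep t₁ h₁ _ _ _ h := absurd h.1 (short_state hn t₁ (hT _ h₁)).1

lemma Good.noClimb_of_mem {m K : ℕ} {T : Finset (List Bool)} (G : Good m K α ε T)
    (hT : SuffixClosed T) {w : List Bool} (hw : w ∈ T) : NoClimb m α ε w :=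
  fun v hv => G.noClimb v (hT.mem hw hv)

lemma Good.addr_ne_nil {m K : ℕ} (hm : 0 < m) (hmn : m < n) {T : Finset (List Bool)}
    (G : Good m K α ε T) (hT : SuffixClosed T) {w : List Bool} (hw : w ∈ T) (hne : w ≠ []) :
    addr α (pos α ε w) ≠ [] := by
  intro h
  have hl : (addr α (pos α ε w)).length = 0 := by rw [h]; rfl
  have hc : ¬ OnCycle (pos α ε w) := by rw [not_onCycle_iff α]; omega
  obtain ⟨h1, h2⟩ := excursion_state hm hmn w (G.noClimb_of_mem hT hw) (fun h => hc h.1)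
  rcases hb : base α ε w with _ | b
  · have := (h1 hb).length_eq
    exact hne (List.length_eq_zero_iff.1 (this.symm.trans hl))
  · have := (h2 b hb).le_length
    omega

/-- The parent of a walk is recovered from its end vertex and its back slot. -/
lemma Good.move_back {m K : ℕ} (hm : 0 < m) (hmn : m < n) {T : Finset (List Bool)}
    (G : Good m K α ε T) (hT : SuffixClosed T) {a : List Bool} (d : Bool) (ha : a ∈ T) :
    move α (pos α ε (d :: a)) (back α ε (d :: a)) = (pos α ε a, outSlot α ε a d) := by
  rw [pos_cons, back_cons]
  apply move_move
  by_cases h : a = []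
  · right; subst h
    have := outSlot_ne_back α ε [] d
    rwa [back_nil] at this
  · left; exact G.addr_ne_nil hm hmn hT ha h

lemma intCast_ne_zero_of_small {N : ℕ} {z : ℤ} (hz : z ≠ 0) (hN : z.natAbs < N) :
    (z : ZMod N) ≠ 0 := by
  rw [Ne, ZMod.intCast_zmod_eq_zero_iff_dvd]
  intro h
  have := Int.natAbs_dvd_natAbs.2 h
  simp only [Int.natAbs_natCast] at this
  have := Nat.le_of_dvd (Int.natAbs_pos.2 hz) this
  omega

lemma dir_eq (s : Bool) (j : Fin 3) : dir s j = 1 ∨ dir s j = -1 := by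
  unfold dir; split_ifs <;> simp

lemma eq_of_dir_eq {s : Bool} {j j' : Fin 3} (hj : j ≠ 0) (hj' : j' ≠ 0) (h : dir s j = dir s j') :
    j = j' := by
  cases s <;> fin_cases j <;> fin_cases j' <;> simp_all [dir]

lemma Good.back_eq {m K : ℕ} (hm : 0 < m) (hmn : m < n) (hK : K < 2 * 2 ^ n)
    {T : Finset (List Bool)} (hTK : ∀ w ∈ T, 2 * w.length ≤ K)
    (G : Good m K α ε T) (hT : SuffixClosed T) {w₁ w₂ : List Bool} (h₁ : w₁ ∈ T) (h₂ : w₂ ∈ T)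
    (h : pos α ε w₁ = pos α ε w₂) : back α ε w₁ = back α ε w₂ := by
  have hn : 0 < n := by omega
  by_cases hc₂ : OnCycle (pos α ε w₂)
  · have hc₁ : OnCycle (pos α ε w₁) := by rwa [h]
    obtain ⟨t₁, k₁, ht₁, hk₁, hl₁, hb₁, he₁⟩ := exists_run hn w₁ hc₁
    obtain ⟨t₂, k₂, ht₂, hk₂, hl₂, hb₂, he₂⟩ := exists_run hn w₂ hc₂
    have hK₁ := hTK _ h₁
    have hK₂ := hTK _ h₂
    rw [h] at he₁
    set e₁ := dir (!(pos α ε w₂).1) (back α ε w₁) with he₁'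
    set e₂ := dir (!(pos α ε w₂).1) (back α ε w₂) with he₂'
    have hd₁ : e₁ = 1 ∨ e₁ = -1 := dir_eq _ _
    have hd₂ : e₂ = 1 ∨ e₂ = -1 := dir_eq _ _
    have hz : (e₂ * k₂ - e₁ * k₁).natAbs ≤ K := by
      rcases hd₁ with hd₁ | hd₁ <;> rcases hd₂ with hd₂ | hd₂ <;> rw [hd₁, hd₂] <;> omega
    have he : nodePos (pos α ε t₁) = nodePos (pos α ε t₂) + ((e₂ * k₂ - e₁ * k₁ : ℤ) :) := by
      rw [he₁] at he₂
      push_cast at he₂ ⊢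
      linear_combination he₂
    have htt : t₁ = t₂ := by
      by_contra hne
      exact G.leaf_sep t₁ (hT.mem h₁ ht₁) t₂ (hT.mem h₂ ht₂) hne hl₁ hl₂ _ hz he
    subst htt
    have hz0 : e₂ * k₂ - e₁ * k₁ = 0 := by
      by_contra hne
      exact intCast_ne_zero_of_small (N := 2 * 2 ^ n) hne (by omega) (by simpa using he)
    have hzero : ∀ {w : List Bool} {k : ℕ}, t₁ <:+ w → t₁.length + k = w.length → k = 0 →
        back α ε w = 0 := by
      intro w k hs hk hk0
      have := hs.eq_of_length (by omega)
      rw [← this]; exact hl₁.2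
    by_cases hk10 : k₁ = 0
    · have hk20 : k₂ = 0 := by
        rcases hd₁ with hd₁ | hd₁ <;> rcases hd₂ with hd₂ | hd₂ <;> rw [hd₁, hd₂] at hz0 <;> omega
      rw [hzero ht₁ hk₁ hk10, hzero ht₂ hk₂ hk20]
    · have hk20 : k₂ ≠ 0 := by
        rcases hd₁ with hd₁ | hd₁ <;> rcases hd₂ with hd₂ | hd₂ <;> rw [hd₁, hd₂] at hz0 <;> omega
      apply eq_of_dir_eq (fun h => hk10 (hb₁ h)) (fun h => hk20 (hb₂ h)) (s := !(pos α ε w₂).1)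
      rw [← he₁', ← he₂']
      rcases hd₁ with hd₁ | hd₁ <;> rcases hd₂ with hd₂ | hd₂ <;> rw [hd₁, hd₂] at hz0 <;> omega
  · have hc₁ : ¬ OnCycle (pos α ε w₁) := by rwa [h]
    obtain ⟨D₁, E₁⟩ := excursion_state hm hmn w₁ (G.noClimb_of_mem hT h₁) (fun h => hc₁ h.1)
    obtain ⟨D₂, E₂⟩ := excursion_state hm hmn w₂ (G.noClimb_of_mem hT h₂) (fun h => hc₂ h.1)
    have hbase : m ≤ (addr α (pos α ε w₂)).length → base α ε w₁ = base α ε w₂ := fun hle =>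
      G.stem_sep w₁ h₁ w₂ h₂ hc₁ hc₂ (by rw [h]) (by rwa [h]) hle (by rw [h])
    rcases hb₂ : base α ε w₂ with _ | b
    · rcases hb₁ : base α ε w₁ with _ | b
      · rw [(D₁ hb₁).back_eq, (D₂ hb₂).back_eq]
      · have := hbase (by rw [← h]; exact (E₁ b hb₁).le_length)
        rw [hb₁, hb₂] at this; simp at this
    · have F₂ := E₂ b hb₂
      have F₁ := E₁ b ((hbase F₂.le_length).trans hb₂)
      have u₁ := F₁.up_or_down
      have u₂ := F₂.up_or_down
      rw [h] at u₁
      rcases u₁ with ⟨c₁, hc₁, hs₁⟩ | ⟨hz₁, hs₁⟩ <;> rcases u₂ with ⟨c₂, hc₂, hs₂⟩ | ⟨hz₂, hs₂⟩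
      · rw [hc₁, hc₂, cons_suffix_cons_of_suffix hs₁ hs₂]
      · exact absurd ((List.suffix_cons _ _).trans hs₁) hs₂
      · exact absurd ((List.suffix_cons _ _).trans hs₂) hs₁
      · rw [hz₁, hz₂]

/-- Walks along words of a good set end at distinct vertices. -/
lemma Good.pos_injOn {m K : ℕ} (hm : 0 < m) (hmn : m < n) (hK : K < 2 * 2 ^ n)
    {T : Finset (List Bool)} (hTK : ∀ w ∈ T, 2 * w.length ≤ K)
    (G : Good m K α ε T) (hT : SuffixClosed T) : ∀ {w₁ w₂ : List Bool}, w₁ ∈ T → w₂ ∈ T →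
    pos α ε w₁ = pos α ε w₂ → w₁ = w₂
  | [], w₂, _, h₂, h => by
    by_contra hne
    apply G.addr_ne_nil hm hmn hT h₂ (Ne.symm hne)
    rw [← h, pos_nil, addr_root (by omega)]
  | d₁ :: a₁, [], h₁, _, h => by
    exfalso
    apply G.addr_ne_nil hm hmn hT h₁ (by simp)
    rw [h, pos_nil, addr_root (by omega)]
  | d₁ :: a₁, d₂ :: a₂, h₁, h₂, h => by
    have hb := G.back_eq hm hmn hK hTK hT h₁ h₂ h
    have e₁ := G.move_back hm hmn hT d₁ (hT.tail_mem _ _ h₁)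
    have e₂ := G.move_back hm hmn hT d₂ (hT.tail_mem _ _ h₂)
    rw [h, hb, e₂, Prod.mk.injEq] at e₁
    obtain rfl := G.pos_injOn hm hmn hK hTK hT (hT.tail_mem _ _ h₁) (hT.tail_mem _ _ h₂) e₁.1.symm
    rw [outSlot_injective α ε a₁ e₁.2]
end

/-! ### Counting attachments and orientations -/

noncomputable instance : Fintype {p : List Bool // p.length < n} :=
  @Fintype.ofFinite _ (List.finite_length_lt Bool n)

noncomputable instance : Fintype (Leaf n) := @Fintype.ofFinite _ (List.finite_length_eq Bool n)

/-- An attachment of the cycle together with an orientation of every vertex. -/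
abbrev Shape (n : ℕ) := Attach n × (Node n → Bool)

lemma walk_eq_of_step_eq {α α' : Attach n} {ε ε' : Node n → Bool} : ∀ w : List Bool,
    (∀ d v, d :: v <:+ w → ε' (pos α ε v) = ε (pos α ε v) ∧
      move α' (pos α ε v) (outSlot α ε v d) = move α (pos α ε v) (outSlot α ε v d)) →
    walk α' ε' w = walk α ε w
  | [], _ => rfl
  | d :: w, h => by
    have ih := walk_eq_of_step_eq w fun d v hv => h d v (hv.trans (List.suffix_cons _ _))
    obtain ⟨h1, h2⟩ := h d w (List.suffix_refl _)
    have hp : pos α' ε' w = pos α ε w := by unfold pos; rw [ih]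
    have hb : back α' ε' w = back α ε w := by unfold back; rw [ih]
    rw [walk_cons, walk_cons, hp, show outSlot α' ε' w d = outSlot α ε w d by
      unfold outSlot; rw [hp, hb, h1], h2]

/-- The orientation with the value at `u` reversed. -/
noncomputable def flipAt (ε : Node n → Bool) (u : Node n) : Node n → Bool :=
  Function.update ε u (!ε u)

lemma flipAt_flipAt (ε : Node n → Bool) (u : Node n) : flipAt (flipAt ε u) u = ε := by
  simp [flipAt]

/-- The walks along suffixes of a word end at distinct vertices. -/
def InjSuffix (α : Attach n) (ε : Node n → Bool) (w : List Bool) : Prop :=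
  ∀ u v, u <:+ w → v <:+ w → pos α ε u = pos α ε v → u = v

/-- Shapes for which the walk along `w` climbs to depth `l`. -/
noncomputable def climbs (w : List Bool) (l : ℕ) : Finset (Shape n) :=
  Finset.univ.filter fun ω => InjSuffix ω.1 ω.2 w.tail ∧ back ω.1 ω.2 w ≠ 0 ∧
    (addr ω.1 (pos ω.1 ω.2 w)).length = l

lemma mem_climbs {w : List Bool} {l : ℕ} {ω : Shape n} : ω ∈ climbs w l ↔
    InjSuffix ω.1 ω.2 w.tail ∧ back ω.1 ω.2 w ≠ 0 ∧ (addr ω.1 (pos ω.1 ω.2 w)).length = l := by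
  rw [climbs, Finset.mem_filter]; simp

lemma walk_flipAt {α : Attach n} {ε : Node n → Bool} {a : List Bool} (h : InjSuffix α ε a)
    {v : List Bool} (hv : v <:+ a) : walk α (flipAt ε (pos α ε a)) v = walk α ε v := by
  apply walk_eq_of_step_eq
  intro d v' hv'
  refine ⟨?_, rfl⟩
  unfold flipAt
  rw [Function.update_of_ne]
  intro he
  have hl := (hv'.trans hv).length_le
  rw [h _ _ ((List.suffix_cons _ _).trans (hv'.trans hv)) (List.suffix_refl _) he] at hl
  simp at hl

lemma turn_not_ne (e d : Bool) : turn (!e) d ≠ turn e d := by revert e d; decide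

lemma climb_step {α : Attach n} {ε : Node n → Bool} {a : List Bool} {d : Bool}
    (hb : back α ε (d :: a) ≠ 0) (hc : ¬ OnCycle (pos α ε (d :: a))) :
    outSlot α ε a d = 0 ∧ back α ε a ≠ 0 ∧
      (addr α (pos α ε a)).length = (addr α (pos α ε (d :: a))).length + 1 := by
  have h0 : outSlot α ε a d = 0 := by
    by_contra h0
    by_cases hca : OnCycle (pos α ε a)
    · exact hc (step_cross h0 hca).2.1
    · exact hb (step_down h0 hca).1
  refine ⟨h0, fun h => outSlot_ne_back α ε a d (h0.trans h.symm), ?_⟩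
  rcases hp : addr α (pos α ε a) with _ | ⟨b, p⟩
  · exact absurd (by rw [back_cons, h0]; simp [move, hp]) hb
  · rw [(step_up h0 hp).2.2.1, List.length_cons]

lemma two_mul_card_climbs_le (d : Bool) (a : List Bool) {l : ℕ} (hl : l < n) :
    2 * (climbs (n := n) (d :: a) l).card ≤ (climbs (n := n) a (l + 1)).card := by
  let F : Shape n → Shape n := fun ω => (ω.1, flipAt ω.2 (pos ω.1 ω.2 a))
  have hwalk : ∀ ω ∈ climbs (d :: a) l, ∀ v, v <:+ a →
      walk (F ω).1 (F ω).2 v = walk ω.1 ω.2 v := by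
    intro ω hω v hv
    exact walk_flipAt (mem_climbs.1 hω).1 hv
  have hpos : ∀ ω ∈ climbs (d :: a) l, pos (F ω).1 (F ω).2 a = pos ω.1 ω.2 a := fun ω hω => by
    unfold pos; rw [hwalk ω hω a (List.suffix_refl _)]
  have hback : ∀ ω ∈ climbs (d :: a) l, back (F ω).1 (F ω).2 a = back ω.1 ω.2 a := fun ω hω => by
    unfold back; rw [hwalk ω hω a (List.suffix_refl _)]
  have hstep : ∀ ω ∈ climbs (n := n) (d :: a) l, InjSuffix ω.1 ω.2 a ∧
      outSlot ω.1 ω.2 a d = 0 ∧ back ω.1 ω.2 a ≠ 0 ∧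
      (addr ω.1 (pos ω.1 ω.2 a)).length = l + 1 := by
    intro ω hω
    obtain ⟨h1, h2, h3⟩ := mem_climbs.1 hω
    have hc : ¬ OnCycle (pos ω.1 ω.2 (d :: a)) := by rw [not_onCycle_iff ω.1, h3]; exact hl
    exact ⟨h1, by simpa only [h3] using climb_step h2 hc⟩
  have htail : ∀ {u : List Bool}, u <:+ a.tail → u <:+ a := fun h => h.trans (List.tail_suffix _)
  have hinj : Set.InjOn F (climbs (d :: a) l : Finset (Shape n)) := by
    intro ω hω ω' hω' h
    have hp : pos ω.1 ω.2 a = pos ω'.1 ω'.2 a := by rw [← hpos ω hω, ← hpos ω' hω', h]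
    have h1 : (F ω).1 = (F ω').1 := by rw [h]
    have h2 : (F ω).2 = (F ω').2 := by rw [h]
    simp only [F] at h2
    rw [hp] at h2
    refine Prod.ext h1 ?_
    rw [← flipAt_flipAt ω.2 (pos ω'.1 ω'.2 a), h2, flipAt_flipAt]
  have hdisj : Disjoint (climbs (d :: a) l) ((climbs (d :: a) l).image F) := by
    rw [Finset.disjoint_right]
    intro ω' hω' hmem
    obtain ⟨ω, hω, rfl⟩ := Finset.mem_image.1 hω'
    have h1 := (hstep _ hmem).2.1
    have h2 := (hstep _ hω).2.1
    rw [outSlot, hpos ω hω, hback ω hω] at h1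
    rw [outSlot, ← h1] at h2
    have := add_left_cancel h2
    simp only [F, flipAt, Function.update_self] at this
    exact turn_not_ne _ _ this.symm
  calc 2 * (climbs (d :: a) l).card
      = (climbs (d :: a) l ∪ (climbs (d :: a) l).image F).card := by
        rw [Finset.card_union_of_disjoint hdisj, Finset.card_image_of_injOn hinj, two_mul]
    _ ≤ (climbs a (l + 1)).card := by
        apply Finset.card_le_card
        apply Finset.union_subset
        · intro ω hω
          obtain ⟨h1, -, h3, h4⟩ := hstep ω hω
          rw [mem_climbs]
          exact ⟨fun u v hu hv => h1 u v (htail hu) (htail hv), h3, h4⟩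
        · intro ω' hω'
          obtain ⟨ω, hω, rfl⟩ := Finset.mem_image.1 hω'
          obtain ⟨h1, -, h3, h4⟩ := hstep ω hω
          rw [mem_climbs]
          rw [hpos ω hω, hback ω hω]
          refine ⟨fun u v hu hv he => h1 u v (htail hu) (htail hv) ?_, h3, h4⟩
          unfold pos at he
          rwa [hwalk ω hω _ (htail hu), hwalk ω hω _ (htail hv)] at he

lemma pow_mul_card_climbs_le : ∀ (h : ℕ) (w : List Bool) (l : ℕ), l + h = n →
    2 ^ h * (climbs (n := n) w l).card ≤ Fintype.card (Shape n)
  | 0, w, l, _ => by simpa using Finset.card_le_univ (climbs (n := n) w l)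
  | h + 1, [], l, _ => by
    have : climbs (n := n) [] l = ∅ := by
      ext ω; simp [climbs, back_nil]
    simp [this]
  | h + 1, d :: a, l, hl => by
    have h1 := two_mul_card_climbs_le (n := n) d a (l := l) (by omega)
    have h2 := pow_mul_card_climbs_le h a (l + 1) (by omega)
    calc 2 ^ (h + 1) * (climbs (n := n) (d :: a) l).card
        = 2 ^ h * (2 * (climbs (n := n) (d :: a) l).card) := by ring
      _ ≤ 2 ^ h * (climbs (n := n) a (l + 1)).card := by gcongr
      _ ≤ _ := h2

/-- No step of the walk along `w` passes between the leaf `x` and its parent. -/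
def Avoids (α : Attach n) (ε : Node n → Bool) (x : Node n) (w : List Bool) : Prop :=
  ∀ d v, d :: v <:+ w → ¬ (pos α ε v = x ∧ outSlot α ε v d = 0) ∧
    ¬ (pos α ε (d :: v) = x ∧ back α ε (d :: v) = 0)

/-- The attachment with two indices on side `s` exchanged. -/
noncomputable def swapAt (α : Attach n) (s : Bool) (i i' : Fin (2 ^ n)) : Attach n :=
  Function.update α s ((Equiv.swap i i').trans (α s))

lemma swapAt_swapAt (α : Attach n) (s : Bool) (i i' : Fin (2 ^ n)) :
    swapAt (swapAt α s i i') s i i' = α := by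
  unfold swapAt
  simp only [Function.update_self, Function.update_idem]
  rw [← Equiv.trans_assoc, ← Equiv.Perm.mul_def, Equiv.swap_mul_self, Equiv.Perm.one_def,
    Equiv.refl_trans, Function.update_eq_self]

lemma addr_swapAt {α : Attach n} {s : Bool} {i i' : Fin (2 ^ n)} {u : Node n}
    (h : u ≠ (s, .inr i)) (h' : u ≠ (s, .inr i')) : addr (swapAt α s i i') u = addr α u := by
  obtain ⟨s', p | k⟩ := u
  · rfl
  · by_cases hs : s' = s
    · subst hs
      simp only [addr, swapAt, Function.update_self, Equiv.trans_apply]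
      rw [Equiv.swap_apply_of_ne_of_ne (by simpa using h) (by simpa using h')]
    · simp [addr, swapAt, hs]

lemma nodeAt_swapAt {α : Attach n} {s : Bool} {i i' : Fin (2 ^ n)} {s' : Bool} {p : List Bool}
    (h : nodeAt α s' p ≠ (s, .inr i)) (h' : nodeAt α s' p ≠ (s, .inr i')) :
    nodeAt (swapAt α s i i') s' p = nodeAt α s' p := by
  unfold nodeAt at *
  split_ifs at * with h1 h2
  · rfl
  · by_cases hs : s' = s
    · subst hs
      simp only [swapAt, Function.update_self, Equiv.symm_trans_apply, Equiv.symm_swap]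
      rw [Equiv.swap_apply_of_ne_of_ne (by simpa using h) (by simpa using h')]
    · simp [swapAt, hs]
  · rfl

lemma move_swapAt {α : Attach n} {s : Bool} {i i' : Fin (2 ^ n)} {u : Node n} {j : Fin 3}
    (h : ∀ k, k = i ∨ k = i' → ¬ (u = (s, .inr k) ∧ j = 0) ∧
      ¬ ((move α u j).1 = (s, .inr k) ∧ (move α u j).2 = 0)) :
    move (swapAt α s i i') u j = move α u j := by
  obtain ⟨h1, h2⟩ := h i (Or.inl rfl)
  obtain ⟨h3, h4⟩ := h i' (Or.inr rfl)
  by_cases hj : j = 0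
  · subst hj
    have ha := addr_swapAt (α := α) (fun h => h1 ⟨h, rfl⟩) (fun h => h3 ⟨h, rfl⟩)
    rcases hp : addr α u with _ | ⟨b, p⟩
    · rw [hp] at ha
      simp [move, ha, hp]
    · have hl := length_addr_le α u
      rw [hp, List.length_cons] at hl
      rw [hp] at ha
      rw [move_zero _ hp, move_zero _ ha]
      have : p.length < n := by omega
      simp [nodeAt, this]
  · by_cases hc : OnCycle u
    · obtain ⟨s', p | k⟩ := u
      · simp [OnCycle] at hc
      · rw [move_cross _ _ _ hj, move_cross _ _ _ hj]
    · have hm := move_down α hc hj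
      have ha : addr (swapAt α s i i') u = addr α u := by
        obtain ⟨s', p | k⟩ := u
        · rfl
        · simp [OnCycle] at hc
      rw [move_down _ hc hj, hm, ha]
      rw [hm] at h2 h4
      rw [nodeAt_swapAt (fun h => h2 ⟨h, rfl⟩) (fun h => h4 ⟨h, rfl⟩)]

lemma walk_swapAt {α : Attach n} {ε : Node n → Bool} {s : Bool} {i i' : Fin (2 ^ n)}
    {w : List Bool} (h : Avoids α ε (s, .inr i) w) (h' : Avoids α ε (s, .inr i') w) :
    walk (swapAt α s i i') ε w = walk α ε w := by
  apply walk_eq_of_step_eq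
  intro d v hv
  refine ⟨rfl, move_swapAt ?_⟩
  rintro k (rfl | rfl)
  · exact h d v hv
  · exact h' d v hv

/-- The cycle indices on side `s` that are not visited along `a` or `c`. -/
noncomputable def unvisited (α : Attach n) (ε : Node n → Bool) (a c : List Bool) (s : Bool) :
    Finset (Fin (2 ^ n)) :=
  Finset.univ.filter fun i => ∀ v, v <:+ a ∨ v <:+ c → pos α ε v ≠ (s, .inr i)

lemma card_unvisited_ge (α : Attach n) (ε : Node n → Bool) (a c : List Bool) (s : Bool) :
    2 ^ n - (a.length + c.length + 2) ≤ (unvisited α ε a c s).card := by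
  let S : Finset (Node n) := ((a.tails ++ c.tails).map (pos α ε)).toFinset
  have hS : S.card ≤ a.length + c.length + 2 := by
    refine (List.toFinset_card_le _).trans ?_
    simp; omega
  have hsub : Finset.univ.image (fun i : Fin (2 ^ n) => ((s, .inr i) : Node n)) ⊆
      S ∪ (unvisited α ε a c s).image (fun i => ((s, .inr i) : Node n)) := by
    intro u hu
    obtain ⟨i, -, rfl⟩ := Finset.mem_image.1 hu
    by_cases hi : i ∈ unvisited α ε a c s
    · exact Finset.mem_union_right _ (Finset.mem_image_of_mem _ hi)
    · apply Finset.mem_union_left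
      simp only [unvisited, Finset.mem_filter, Finset.mem_univ, true_and] at hi
      push Not at hi
      obtain ⟨v, hv, he⟩ := hi
      simp only [S, List.mem_toFinset, List.mem_map, List.mem_append, List.mem_tails]
      exact ⟨v, hv, he⟩
  have hinj : Function.Injective fun i : Fin (2 ^ n) => ((s, .inr i) : Node n) := by
    intro i j h; simpa using h
  have := (Finset.card_le_card hsub).trans (Finset.card_union_le _ _)
  rw [Finset.card_image_of_injective _ hinj, Finset.card_image_of_injective _ hinj,
    Finset.card_univ, Fintype.card_fin] at this
  omega

/-- If the attachment at some leaf index can be decoded from two walks that avoid it, the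
orientation and a code word, then exchanging indices bounds the number of shapes. -/
lemma card_mul_le_of_decode {Y : Type*} [Fintype Y] (a c : List Bool) (Z : Finset (Shape n))
    (dec : Node n × Fin 3 → Node n × Fin 3 → (Node n → Bool) → Y → Bool × Fin (2 ^ n) × List Bool)
    (code : Shape n → Y)
    (h : ∀ ω ∈ Z, ∀ s i p, dec (walk ω.1 ω.2 a) (walk ω.1 ω.2 c) ω.2 (code ω) = (s, i, p) →
      (ω.1 s i).1 = p ∧ Avoids ω.1 ω.2 (s, .inr i) a ∧ Avoids ω.1 ω.2 (s, .inr i) c) :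
    Z.card * (2 ^ n - (a.length + c.length + 2)) ≤ Fintype.card Y * Fintype.card (Shape n) := by
  let D : Shape n → Bool × Fin (2 ^ n) × List Bool := fun ω =>
    dec (walk ω.1 ω.2 a) (walk ω.1 ω.2 c) ω.2 (code ω)
  let F : (Σ _ : Shape n, Fin (2 ^ n)) → Y × Shape n := fun x =>
    (code x.1, (swapAt x.1.1 (D x.1).1 (D x.1).2.1 x.2, x.1.2))
  let S : Finset (Σ _ : Shape n, Fin (2 ^ n)) := Z.sigma fun ω => unvisited ω.1 ω.2 a c (D ω).1
  have hav : ∀ x ∈ S, ∀ w, w = a ∨ w = c →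
      walk (F x).2.1 (F x).2.2 w = walk x.1.1 x.1.2 w := by
    rintro ⟨ω, i'⟩ hx w hw
    obtain ⟨hω, hi'⟩ := Finset.mem_sigma.1 hx
    obtain ⟨-, h1, h2⟩ := h ω hω _ _ _ rfl
    simp only [unvisited, Finset.mem_filter, Finset.mem_univ, true_and] at hi'
    have h3 : ∀ v, v <:+ w → pos ω.1 ω.2 v ≠ ((D ω).1, .inr i') := by
      rcases hw with rfl | rfl
      · exact fun v hv => hi' v (Or.inl hv)
      · exact fun v hv => hi' v (Or.inr hv)
    apply walk_swapAt
    · rcases hw with rfl | rfl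
      · exact h1
      · exact h2
    · exact fun d v hv => ⟨fun hh => h3 v ((List.suffix_cons _ _).trans hv) hh.1,
        fun hh => h3 _ hv hh.1⟩
  have hinj : Set.InjOn F S := by
    intro x hx y hy hxy
    have hD : D x.1 = D y.1 := by
      have e1 := hav x hx a (Or.inl rfl)
      have e2 := hav y hy a (Or.inl rfl)
      have e3 := hav x hx c (Or.inr rfl)
      have e4 := hav y hy c (Or.inr rfl)
      have e5 : code x.1 = code y.1 := congrArg Prod.fst hxy
      have e6 : x.1.2 = y.1.2 := congrArg (fun z => z.2.2) hxy
      simp only [D]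
      rw [← e1, ← e2, ← e3, ← e4, hxy, e5, e6]
    have hαα : swapAt x.1.1 (D x.1).1 (D x.1).2.1 x.2 = swapAt y.1.1 (D y.1).1 (D y.1).2.1 y.2 :=
      congrArg (fun z => z.2.1) hxy
    have hval : ∀ z ∈ S,
        (swapAt z.1.1 (D z.1).1 (D z.1).2.1 z.2 (D z.1).1 z.2).1 = (D z.1).2.2 := by
      intro z hz
      obtain ⟨h1, -, -⟩ := h z.1 (Finset.mem_sigma.1 hz).1 _ _ _ rfl
      simpa [swapAt] using h1
    have hii : x.2 = y.2 := by
      have h1 := hval x hx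
      have h2 := hval y hy
      rw [hαα, hD, ← h2] at h1
      exact (swapAt y.1.1 (D y.1).1 (D y.1).2.1 y.2 (D y.1).1).injective (Subtype.ext h1)
    have hα : x.1.1 = y.1.1 := by
      rw [← swapAt_swapAt x.1.1 (D x.1).1 (D x.1).2.1 x.2, hαα, hD, hii, swapAt_swapAt]
    have h1 : x.1 = y.1 := Prod.ext hα (congrArg (fun z => z.2.2) hxy)
    obtain ⟨x1, x2⟩ := x
    obtain ⟨y1, y2⟩ := y
    simp only at h1 hii
    rw [h1, hii]
  calc Z.card * (2 ^ n - (a.length + c.length + 2)) ≤ S.card := by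
        rw [Finset.card_sigma]
        exact Finset.card_nsmul_le_sum _ _ _ fun ω _ => card_unvisited_ge _ _ _ _ _
    _ ≤ Fintype.card (Y × Shape n) := by
        rw [← Finset.card_image_of_injOn hinj]
        exact Finset.card_le_univ _
    _ = _ := by rw [Fintype.card_prod]

/-- The address of an internal vertex. -/
def innerAddr (u : Node n) : List Bool :=
  match u.2 with
  | .inl p => p.1
  | .inr _ => []

/-- The cycle index of a leaf. -/
def leafIndex (u : Node n) : Fin (2 ^ n) :=
  match u.2 with
  | .inl _ => 0
  | .inr i => i

lemma innerAddr_eq (α : Attach n) {u : Node n} (h : ¬ OnCycle u) : innerAddr u = addr α u := by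
  obtain ⟨s, p | i⟩ := u
  · rfl
  · simp [OnCycle] at h

lemma OnCycle.eq_mk {u : Node n} (h : OnCycle u) : u = (u.1, .inr (leafIndex u)) := by
  obtain ⟨s, p | i⟩ := u
  · simp [OnCycle] at h
  · rfl

lemma card_leaf (h : ℕ) : Fintype.card (Leaf h) = 2 ^ h := by
  have : Fintype.card (Leaf h) = Fintype.card (List.Vector Bool h) :=
    Fintype.card_congr (Equiv.refl _)
  rw [this, card_vector, Fintype.card_bool]

lemma cyclePos_injective : Function.Injective (cyclePos (n := n)) := by
  rintro ⟨s, i⟩ ⟨s', i'⟩ h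
  have hc : ∀ (s : Bool) (i : Fin (2 ^ n)), cyclePos (s, i) =
      ((2 * i.val + (bif s then 1 else 0) : ℕ) : ZMod (2 * 2 ^ n)) := by
    intro s i; cases s <;> simp [cyclePos]
  rw [hc, hc, ZMod.natCast_eq_natCast_iff] at h
  have h1 := i.2
  have h2 := i'.2
  have := h.eq_of_lt_of_lt (by cases s <;> simp only [cond_true, cond_false] <;> omega)
    (by cases s' <;> simp only [cond_true, cond_false] <;> omega)
  have hs : s = s' := by cases s <;> cases s' <;> simp at this ⊢ <;> omega
  subst hs
  simp only [Prod.mk.injEq, true_and]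
  exact Fin.ext (by omega)

/-- Shapes for which the leaf reached along `x` shares its stem with the internal vertex reached
along `y` are rare. -/
lemma card_stem_hit_le {m h : ℕ} (hmh : m + h = n) (x y : List Bool) (Z : Finset (Shape n))
    (hZ : ∀ ω ∈ Z, OnCycle (pos ω.1 ω.2 x) ∧ ¬ OnCycle (pos ω.1 ω.2 y) ∧
      stem m (addr ω.1 (pos ω.1 ω.2 x)) = stem m (addr ω.1 (pos ω.1 ω.2 y)) ∧
      Avoids ω.1 ω.2 (pos ω.1 ω.2 x) x ∧ Avoids ω.1 ω.2 (pos ω.1 ω.2 x) y) :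
    Z.card * (2 ^ n - (x.length + y.length + 2)) ≤ 2 ^ h * Fintype.card (Shape n) := by
  rw [← card_leaf h]
  let code : Shape n → Leaf h := fun ω =>
    if hl : ((addr ω.1 (pos ω.1 ω.2 x)).take h).length = h then ⟨_, hl⟩
    else ⟨List.replicate h false, by simp⟩
  refine card_mul_le_of_decode x y Z
    (fun wx wy _ c => (wx.1.1, leafIndex wx.1, c.1 ++ stem m (innerAddr wy.1))) code ?_
  intro ω hω s i p hd
  obtain ⟨h1, h2, h3, h4, h5⟩ := hZ ω hω
  simp only [Prod.mk.injEq] at hd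
  obtain ⟨rfl, rfl, rfl⟩ := hd
  have hx : pos ω.1 ω.2 x = ((walk ω.1 ω.2 x).1.1, .inr (leafIndex (walk ω.1 ω.2 x).1)) := h1.eq_mk
  rw [← hx]
  refine ⟨?_, h4, h5⟩
  have hlen := (onCycle_iff ω.1 _).1 h1
  have hcode : (code ω).1 = (addr ω.1 (pos ω.1 ω.2 x)).take h := by
    simp only [code]
    rw [dif_pos (by rw [List.length_take]; omega)]
  have hy : innerAddr (walk ω.1 ω.2 y).1 = addr ω.1 (pos ω.1 ω.2 y) := innerAddr_eq ω.1 h2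
  rw [hcode, hy, ← h3, stem, hlen, show n - m = h by omega, List.take_append_drop]
  have := congrArg (addr ω.1) hx
  simpa [addr] using this.symm

/-- Shapes for which the leaf reached along `d :: a` from inside its tree has a prescribed
position relative to the leaf reached along `t` are rare. -/
lemma card_leaf_hit_le (d : Bool) (a t : List Bool) (z : ℤ) (Z : Finset (Shape n))
    (hZ : ∀ ω ∈ Z, OnCycle (pos ω.1 ω.2 (d :: a)) ∧ ¬ OnCycle (pos ω.1 ω.2 a) ∧
      outSlot ω.1 ω.2 a d ≠ 0 ∧
      nodePos (pos ω.1 ω.2 (d :: a)) = nodePos (pos ω.1 ω.2 t) + z ∧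
      Avoids ω.1 ω.2 (pos ω.1 ω.2 (d :: a)) a ∧ Avoids ω.1 ω.2 (pos ω.1 ω.2 (d :: a)) t) :
    Z.card * (2 ^ n - (a.length + t.length + 2)) ≤ Fintype.card (Shape n) := by
  have key := card_mul_le_of_decode (Y := Unit) a t Z
    (fun wa wt ε _ => ((Function.invFun cyclePos (nodePos wt.1 + (z : ZMod (2 * 2 ^ n)))).1,
      (Function.invFun cyclePos (nodePos wt.1 + (z : ZMod (2 * 2 ^ n)))).2,
      (wa.2 + turn (ε wa.1) d == 2) :: innerAddr wa.1)) (fun _ => ()) ?_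
  · simpa using key
  intro ω hω s i p hd
  obtain ⟨h1, h2, h3, h4, h5, h6⟩ := hZ ω hω
  simp only [Prod.mk.injEq] at hd
  obtain ⟨rfl, rfl, rfl⟩ := hd
  have hw := h1.eq_mk
  have hinv : Function.invFun cyclePos (nodePos (walk ω.1 ω.2 t).1 + (z : ZMod (2 * 2 ^ n))) =
      ((pos ω.1 ω.2 (d :: a)).1, leafIndex (pos ω.1 ω.2 (d :: a))) := by
    have : nodePos (walk ω.1 ω.2 t).1 + z =
        cyclePos ((pos ω.1 ω.2 (d :: a)).1, leafIndex (pos ω.1 ω.2 (d :: a))) := by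
      refine h4.symm.trans ?_
      conv_lhs => rw [hw]
      rfl
    rw [this]
    exact Function.leftInverse_invFun cyclePos_injective _
  rw [hinv]
  simp only
  rw [← hw]
  refine ⟨?_, h5, h6⟩
  have ha : innerAddr (walk ω.1 ω.2 a).1 = addr ω.1 (pos ω.1 ω.2 a) := innerAddr_eq ω.1 h2
  rw [ha]
  have h7 := (step_down h3 h2).2.1
  have h8 := congrArg (addr ω.1) hw
  rw [h7] at h8
  exact h8.symm

section
variable {α : Attach n} {ε : Node n → Bool} {m K : ℕ} {T : Finset (List Bool)}
  {a : List Bool} {d : Bool}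

/-- A climb out of a leaf onto a new word avoids that leaf on all earlier words. -/
lemma Good.avoids_of_climb (hm : 0 < m) (hmn : m < n) (hK : K < 2 * 2 ^ n)
    (hTK : ∀ w ∈ T, 2 * w.length ≤ K) (G : Good m K α ε T) (hT : SuffixClosed T) (ha : a ∈ T)
    (hw : d :: a ∉ T) (h0 : outSlot α ε a d = 0) {c : List Bool} (hc : c ∈ T) :
    Avoids α ε (pos α ε a) c := by
  intro d' v hv
  have hdv := hT.mem hc hv
  constructor
  · rintro ⟨hp, ho⟩
    obtain rfl := G.pos_injOn hm hmn hK hTK hT (hT.tail_mem _ _ hdv) ha hp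
    exact hw ((outSlot_injective α ε v (ho.trans h0.symm)) ▸ hdv)
  · rintro ⟨hp, hb⟩
    rw [G.pos_injOn hm hmn hK hTK hT hdv ha hp] at hb
    exact outSlot_ne_back α ε a d (h0.trans hb.symm)

/-- Words that end at internal vertices together with all their suffixes avoid every leaf. -/
lemma avoids_of_short (hn : 0 < n) {x : Node n} (hx : OnCycle x) {w : List Bool}
    (hw : w.length < n) : Avoids α ε x w := by
  intro d' v hv
  have hl := hv.length_le
  simp only [List.length_cons] at hl
  constructor
  · rintro ⟨rfl, -⟩
    exact (short_state hn v (by omega)).1 hx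
  · rintro ⟨rfl, -⟩
    exact (short_state hn (d' :: v) (by simp; omega)).1 hx

/-- A leaf reached by crossing the cycle is avoided by the word leading to it. -/
lemma Good.avoids_self (hm : 0 < m) (hmn : m < n) (hK : K < 2 * 2 ^ n)
    (hTK : ∀ w ∈ T, 2 * w.length ≤ K) (G : Good m K α ε T) (hT : SuffixClosed T) {b : List Bool}
    (hb : b ∈ T) (hback : back α ε b ≠ 0) : Avoids α ε (pos α ε b) b := by
  intro d' v hv
  have hdv := hT.mem hb hv
  constructor
  · rintro ⟨hp, -⟩
    have := hv.length_le
    rw [G.pos_injOn hm hmn hK hTK hT (hT.tail_mem _ _ hdv) hb hp] at this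
    simp at this
  · rintro ⟨hp, h0⟩
    rw [G.pos_injOn hm hmn hK hTK hT hdv hb hp] at h0
    exact hback h0

/-- A leaf entered from its tree by a new word is avoided by all earlier words. -/
lemma Good.avoids_of_enter (hm : 0 < m) (hmn : m < n) (hK : K < 2 * 2 ^ n)
    (hTK : ∀ w ∈ T, 2 * w.length ≤ K) (G : Good m K α ε T) (hT : SuffixClosed T) (ha : a ∈ T)
    (hw : d :: a ∉ T) (hb : back α ε (d :: a) = 0) {c : List Bool} (hc : c ∈ T) :
    Avoids α ε (pos α ε (d :: a)) c := by
  have hmv := G.move_back hm hmn hT d ha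
  rw [hb] at hmv
  intro d' v hv
  have hdv := hT.mem hc hv
  have hv' := hT.tail_mem _ _ hdv
  constructor
  · rintro ⟨hp, ho⟩
    have h1 : pos α ε (d' :: v) = pos α ε a := by rw [pos_cons, hp, ho, hmv]
    have h2 : back α ε (d' :: v) = outSlot α ε a d := by rw [back_cons, hp, ho, hmv]
    rw [G.pos_injOn hm hmn hK hTK hT hdv ha h1] at h2
    exact outSlot_ne_back α ε a d h2.symm
  · rintro ⟨hp, h0⟩
    have h1 := G.move_back hm hmn hT d' hv'
    rw [hp, h0, hmv, Prod.mk.injEq] at h1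
    obtain rfl := G.pos_injOn hm hmn hK hTK hT ha hv' h1.1
    exact hw ((outSlot_injective α ε a h1.2) ▸ hdv)

/-- The climb out of the leaf `a` onto `d :: a` hits the stem of the vertex reached along `c`. -/
def ClimbHit (m : ℕ) (α : Attach n) (ε : Node n → Bool) (d : Bool) (a c : List Bool) : Prop :=
  OnCycle (pos α ε a) ∧ outSlot α ε a d = 0 ∧ ¬ OnCycle (pos α ε c) ∧
    stem m (addr α (pos α ε a)) = stem m (addr α (pos α ε c))

/-- The initial descent along `w` hits the stem of the leaf at which the excursion `b` started. -/
def DescentHit (m : ℕ) (α : Attach n) (ε : Node n → Bool) (w b : List Bool) : Prop :=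
  OnCycle (pos α ε b) ∧ back α ε b ≠ 0 ∧ w.length < n ∧
    stem m (addr α (pos α ε b)) = stem m (addr α (pos α ε w))

/-- The leaf entered along `d :: a` lies at distance `z` from the leaf reached along `t`. -/
def LeafHit (α : Attach n) (ε : Node n → Bool) (d : Bool) (a t : List Bool) (z : ℤ) : Prop :=
  TreeLeaf α ε (d :: a) ∧ ¬ OnCycle (pos α ε a) ∧ outSlot α ε a d ≠ 0 ∧
    nodePos (pos α ε (d :: a)) = nodePos (pos α ε t) + z

lemma treeLeaf_step (hn : 0 < n) (h : TreeLeaf α ε (d :: a)) :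
    ¬ OnCycle (pos α ε a) ∧ outSlot α ε a d ≠ 0 := by
  have h0 : outSlot α ε a d ≠ 0 := by
    intro h0
    rcases hp : addr α (pos α ε a) with _ | ⟨b, p⟩
    · have h1 : pos α ε (d :: a) = pos α ε a := by rw [pos_cons, h0]; simp [move, hp]
      have := (onCycle_iff α _).1 h.1
      rw [h1, hp] at this
      simp at this; omega
    · exact (step_up h0 hp).2.2.2.2 h.1
  refine ⟨fun hc => h0 ?_, h0⟩
  rw [← (step_cross h0 hc).1]
  exact h.2

/-- The ways in which a good set can be spoiled by a new word. -/
lemma Good.insert_or (hm : 0 < m) (hmn : m < n) (hK : K < 2 * 2 ^ n)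
    (hTK : ∀ w ∈ T, 2 * w.length ≤ K) (G : Good m K α ε T) (hT : SuffixClosed T) (ha : a ∈ T)
    (hbad : ¬ Good m K α ε (insert (d :: a) T)) :
    (α, ε) ∈ climbs (d :: a) m ∨ (∃ c ∈ T, ClimbHit m α ε d a c) ∨
      (∃ b ∈ T, DescentHit m α ε (d :: a) b) ∨
      ∃ t ∈ T, ∃ z ∈ Finset.Icc (-(K : ℤ)) K, LeafHit α ε d a t z := by
  have hn : 0 < n := by omega
  by_contra! H
  obtain ⟨H1, H2, H3, H4⟩ := H
  have hnc : back α ε (d :: a) ≠ 0 → ¬ OnCycle (pos α ε (d :: a)) →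
      m < (addr α (pos α ε (d :: a))).length := by
    intro hb hc
    obtain ⟨-, h2, h3⟩ := climb_step hb hc
    have hle : m ≤ (addr α (pos α ε (d :: a))).length := by
      by_cases hca : OnCycle (pos α ε a)
      · have := (onCycle_iff α _).1 hca
        omega
      · have := G.noClimb a ha h2 hca
        omega
    refine lt_of_le_of_ne hle fun he => H1 (mem_climbs.2 ⟨?_, hb, he.symm⟩)
    exact fun u v hu hv => G.pos_injOn hm hmn hK hTK hT (hT.mem ha hu) (hT.mem ha hv)
  have hNC : NoClimb m α ε (d :: a) := by
    intro v hv
    rcases List.suffix_cons_iff.1 hv with rfl | hv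
    · exact hnc
    · exact G.noClimb v (hT.mem ha hv)
  have hstem : ∀ c ∈ T, ¬ OnCycle (pos α ε (d :: a)) → ¬ OnCycle (pos α ε c) →
      (pos α ε (d :: a)).1 = (pos α ε c).1 → m ≤ (addr α (pos α ε (d :: a))).length →
      m ≤ (addr α (pos α ε c)).length →
      stem m (addr α (pos α ε (d :: a))) = stem m (addr α (pos α ε c)) →
      base α ε (d :: a) = base α ε c := by
    intro c hc hw1 hc1 hside hlw hlc hst
    obtain ⟨D, E⟩ := excursion_state hm hmn (d :: a) hNC (fun h => hw1 h.1)
    by_cases hca : OnCycle (pos α ε a)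
    · exfalso
      have h0 : outSlot α ε a d = 0 := by
        by_contra h0
        exact hw1 (step_cross h0 hca).2.1
      have hb : base α ε (d :: a) = some a := by simp [base, hca, hw1]
      exact H2 c hc ⟨hca, h0, hc1, (E a hb).stem_eq.symm.trans hst⟩
    · have hb : base α ε (d :: a) = base α ε a := by simp [base, hca]
      have hcase : (m ≤ (addr α (pos α ε a)).length ∧ (pos α ε a).1 = (pos α ε (d :: a)).1 ∧
          stem m (addr α (pos α ε a)) = stem m (addr α (pos α ε (d :: a)))) ∨
          (addr α (pos α ε a)).length + 1 = m ∧ (addr α (pos α ε (d :: a))).length = m := by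
        by_cases h0 : outSlot α ε a d = 0
        · left
          rcases hp : addr α (pos α ε a) with _ | ⟨b, p⟩
          · have h1 : pos α ε (d :: a) = pos α ε a := by rw [pos_cons, h0]; simp [move, hp]
            rw [h1, hp] at hlw
            simp at hlw; omega
          · obtain ⟨-, -, h3, h4, -⟩ := step_up h0 hp
            rw [h3] at hlw ⊢
            exact ⟨by simp; omega, h4.symm, stem_cons hlw b⟩
        · obtain ⟨-, h2, h3⟩ := step_down h0 hca
          rw [h2] at hlw ⊢
          by_cases hle : m ≤ (addr α (pos α ε a)).length
          · exact Or.inl ⟨hle, h3.symm, (stem_cons hle _).symm⟩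
          · rw [List.length_cons] at hlw ⊢
            exact Or.inr ⟨by omega, by omega⟩
      rcases hcase with ⟨h1, h2, h3⟩ | ⟨h1, h2⟩
      · rw [hb]
        exact G.stem_sep a ha c hc hca hc1 (h2.trans hside) h1 hlc (h3.trans hst)
      · have hba : base α ε a = none := by
          rcases hba : base α ε a with _ | b
          · rfl
          · have := ((excursion_state hm hmn a (G.noClimb_of_mem hT ha)
              (fun h => hca h.1)).2 b hba).le_length
            omega
        rw [hb, hba]
        rcases hbc : base α ε c with _ | b
        · rfl
        exfalso
        have Ec := (excursion_state hm hmn c (G.noClimb_of_mem hT hc) (fun h => hc1 h.1)).2 b hbc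
        have hlen := (D (hb.trans hba)).length_eq
        exact H3 b (hT.mem hc Ec.suffix) ⟨Ec.onCycle, Ec.back_ne, by omega,
          Ec.stem_eq.symm.trans hst.symm⟩
  have hleaf : ∀ t ∈ T, TreeLeaf α ε (d :: a) → ∀ z : ℤ, z.natAbs ≤ K →
      nodePos (pos α ε (d :: a)) ≠ nodePos (pos α ε t) + z := by
    intro t ht hl z hz he
    obtain ⟨h1, h2⟩ := treeLeaf_step hn hl
    exact H4 t ht z (Finset.mem_Icc.2 ⟨by omega, by omega⟩) ⟨hl, h1, h2, he⟩
  apply hbad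
  refine ⟨?_, ?_, ?_⟩
  · intro w hw
    rcases Finset.mem_insert.1 hw with rfl | hw
    · exact hnc
    · exact G.noClimb w hw
  · intro w₁ h₁ w₂ h₂
    rcases Finset.mem_insert.1 h₁ with rfl | h₁ <;> rcases Finset.mem_insert.1 h₂ with rfl | h₂
    · intros; rfl
    · exact hstem w₂ h₂
    · intro c1 c2 hs l1 l2 hst
      exact (hstem w₁ h₁ c2 c1 hs.symm l2 l1 hst.symm).symm
    · exact G.stem_sep w₁ h₁ w₂ h₂
  · intro t₁ h₁ t₂ h₂
    rcases Finset.mem_insert.1 h₁ with rfl | h₁ <;> rcases Finset.mem_insert.1 h₂ with rfl | h₂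
    · intro h; exact absurd rfl h
    · exact fun _ hl _ => hleaf t₂ h₂ hl
    · intro _ _ hl z hz he
      refine hleaf t₁ h₁ hl (-z) (by omega) ?_
      rw [he]; push_cast; ring
    · exact G.leaf_sep t₁ h₁ t₂ h₂
end

/-- Shapes for which the word `w` spoils the good set `T`. -/
noncomputable def spoiled (n m K : ℕ) (T : Finset (List Bool)) (w : List Bool) :
    Finset (Shape n) :=
  Finset.univ.filter fun ω => Good m K ω.1 ω.2 T ∧ ¬ Good m K ω.1 ω.2 (insert w T)

lemma card_spoiled_le {m h K : ℕ} (hm : 0 < m) (hh : 0 < h) (hmh : m + h = n)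
    (hK : K < 2 * 2 ^ n) {T : Finset (List Bool)} (hT : SuffixClosed T)
    (hTK : ∀ w ∈ T, 2 * w.length ≤ K) {a : List Bool} {d : Bool} (ha : a ∈ T) (hw : d :: a ∉ T)
    {M : ℕ} (hM : 0 < M) (hMK : M + K + 3 ≤ 2 ^ n) :
    ((spoiled n m K T (d :: a)).card : ℝ) ≤ Fintype.card (Shape n) *
      (1 / 2 ^ h + T.card * (2 * 2 ^ h + (2 * K + 1)) / M) := by
  have hmn : m < n := by omega
  let ZA : List Bool → Finset (Shape n) := fun c =>
    Finset.univ.filter fun ω => Good m K ω.1 ω.2 T ∧ ClimbHit m ω.1 ω.2 d a c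
  let ZB : List Bool → Finset (Shape n) := fun b =>
    Finset.univ.filter fun ω => Good m K ω.1 ω.2 T ∧ DescentHit m ω.1 ω.2 (d :: a) b
  let ZC : List Bool → ℤ → Finset (Shape n) := fun t z =>
    Finset.univ.filter fun ω => Good m K ω.1 ω.2 T ∧ LeafHit ω.1 ω.2 d a t z
  have hsub : spoiled n m K T (d :: a) ⊆ climbs (d :: a) m ∪ (T.biUnion ZA ∪ (T.biUnion ZB ∪
      T.biUnion fun t => (Finset.Icc (-(K : ℤ)) K).biUnion (ZC t))) := by
    intro ω hω
    obtain ⟨-, G, hbad⟩ := Finset.mem_filter.1 hω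
    simp only [Finset.mem_union, Finset.mem_biUnion, ZA, ZB, ZC, Finset.mem_filter,
      Finset.mem_univ, true_and]
    rcases G.insert_or hm hmn hK hTK hT ha hbad with h | ⟨c, hc, h⟩ | ⟨b, hb, h⟩ | ⟨t, ht, z, hz, h⟩
    · exact Or.inl h
    · exact Or.inr (Or.inl ⟨c, hc, G, h⟩)
    · exact Or.inr (Or.inr (Or.inl ⟨b, hb, G, h⟩))
    · exact Or.inr (Or.inr (Or.inr ⟨t, ht, z, hz, G, h⟩))
  have hla := hTK a ha
  have real_bound : ∀ {c L B : ℕ}, M ≤ L → c * L ≤ B → (c : ℝ) ≤ B / M := by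
    intro c L B h1 h2
    rw [le_div_iff₀ (by exact_mod_cast hM)]
    exact_mod_cast (Nat.mul_le_mul_left c h1).trans h2
  set S := Fintype.card (Shape n) with hS
  have hA : ∀ c ∈ T, ((ZA c).card : ℝ) ≤ (2 ^ h * S : ℕ) / M := by
    intro c hc
    have hlc := hTK c hc
    refine real_bound (L := 2 ^ n - (a.length + c.length + 2)) (by omega)
      (card_stem_hit_le hmh a c _ fun ω hω => ?_)
    obtain ⟨-, G, h1, h2, h3, h4⟩ := Finset.mem_filter.1 hω
    exact ⟨h1, h3, h4, G.avoids_of_climb hm hmn hK hTK hT ha hw h2 ha,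
      G.avoids_of_climb hm hmn hK hTK hT ha hw h2 hc⟩
  have hB : ∀ b ∈ T, ((ZB b).card : ℝ) ≤ (2 ^ h * S : ℕ) / M := by
    intro b hb
    have hlb := hTK b hb
    refine real_bound (L := 2 ^ n - (b.length + (d :: a).length + 2))
      (by rw [List.length_cons]; omega) (card_stem_hit_le hmh b (d :: a) _ fun ω hω => ?_)
    obtain ⟨-, G, h1, h2, h3, h4⟩ := Finset.mem_filter.1 hω
    exact ⟨h1, (short_state (by omega) _ h3).1, h4, G.avoids_self hm hmn hK hTK hT hb h2,
      avoids_of_short (by omega) h1 h3⟩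
  have hC : ∀ t ∈ T, ∀ z : ℤ, ((ZC t z).card : ℝ) ≤ S / M := by
    intro t ht z
    have hlt := hTK t ht
    refine real_bound (L := 2 ^ n - (a.length + t.length + 2)) (by omega)
      (card_leaf_hit_le d a t z _ fun ω hω => ?_)
    obtain ⟨-, G, h1, h2, h3, h4⟩ := Finset.mem_filter.1 hω
    exact ⟨h1.1, h2, h3, h4, G.avoids_of_enter hm hmn hK hTK hT ha hw h1.2 ha,
      G.avoids_of_enter hm hmn hK hTK hT ha hw h1.2 ht⟩
  have hcl : ((climbs (n := n) (d :: a) m).card : ℝ) ≤ S / 2 ^ h := by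
    rw [le_div_iff₀ (by positivity), mul_comm]
    exact_mod_cast pow_mul_card_climbs_le h (d :: a) m hmh
  have hUA : ((T.biUnion ZA).card : ℝ) ≤ T.card * ((2 ^ h * S : ℕ) / M) := by
    refine (Nat.cast_le.2 Finset.card_biUnion_le).trans ?_
    push_cast
    rw [← nsmul_eq_mul]
    exact Finset.sum_le_card_nsmul _ _ _ (by simpa using hA)
  have hUB : ((T.biUnion ZB).card : ℝ) ≤ T.card * ((2 ^ h * S : ℕ) / M) := by
    refine (Nat.cast_le.2 Finset.card_biUnion_le).trans ?_
    push_cast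
    rw [← nsmul_eq_mul]
    exact Finset.sum_le_card_nsmul _ _ _ (by simpa using hB)
  have hUC : ((T.biUnion fun t => (Finset.Icc (-(K : ℤ)) K).biUnion (ZC t)).card : ℝ) ≤
      T.card * ((2 * K + 1) * (S / M)) := by
    refine (Nat.cast_le.2 Finset.card_biUnion_le).trans ?_
    push_cast
    rw [← nsmul_eq_mul]
    refine Finset.sum_le_card_nsmul _ _ _ fun t ht => ?_
    refine (Nat.cast_le.2 Finset.card_biUnion_le).trans ?_
    push_cast
    refine (Finset.sum_le_card_nsmul _ _ _ fun z _ => hC t ht z).trans ?_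
    rw [Int.card_Icc, nsmul_eq_mul, show ((K : ℤ) + 1 - -K).toNat = 2 * K + 1 by omega]
    push_cast
    exact le_rfl
  have hle : (spoiled n m K T (d :: a)).card ≤ (climbs (n := n) (d :: a) m).card +
      ((T.biUnion ZA).card + ((T.biUnion ZB).card +
        (T.biUnion fun t => (Finset.Icc (-(K : ℤ)) K).biUnion (ZC t)).card)) := by
    refine (Finset.card_le_card hsub).trans ?_
    refine (Finset.card_union_le _ _).trans (Nat.add_le_add_left ?_ _)
    refine (Finset.card_union_le _ _).trans (Nat.add_le_add_left ?_ _)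
    exact Finset.card_union_le _ _
  calc ((spoiled n m K T (d :: a)).card : ℝ)
      ≤ (climbs (n := n) (d :: a) m).card +
      ((T.biUnion ZA).card + ((T.biUnion ZB).card +
        (T.biUnion fun t => (Finset.Icc (-(K : ℤ)) K).biUnion (ZC t)).card)) := by
        exact_mod_cast hle
    _ ≤ S / 2 ^ h + (T.card * ((2 ^ h * S : ℕ) / M) + (T.card * ((2 ^ h * S : ℕ) / M) +
        T.card * ((2 * K + 1) * (S / M)))) := by gcongr
    _ = _ := by push_cast; ring

/-! ### The oracle in terms of walks -/

/-- An oracle instance with leaves named by their position on the cycle: the shape, an offset for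
the slot labels of every vertex, and the naming. -/
abbrev Model (n : ℕ) :=
  Shape n × (Node n → Fin 3) × {ν : Node n ↪ Names n // ν (root n false) = fun _ => false}

/-- Oracle answers. -/
abbrev Answer (n : ℕ) := Option (Finset (Names n × (Fin 3 × Fin 3)))

/-- Lists of queries with their answers. -/
abbrev Transcript (n : ℕ) := List (Names n × Answer n)

/-- The label of slot `j` for orientation `e` and offset `r`. -/
def slotLabel (e : Bool) (r j : Fin 3) : Fin 3 := bif e then r + j else r - j

lemma slotLabel_add_turn (e : Bool) (r j : Fin 3) (d : Bool) :
    slotLabel e r (j + turn e d) = slotLabel e r j + bitSlot d := by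
  revert e r j d; decide

/-- An edge color, the label at the endpoint of even parity first. -/
def colorPair (k : ℕ) (x y : Fin 3) : Fin 3 × Fin 3 := if k % 2 = 0 then (x, y) else (y, x)

lemma colorPair_congr {k l : ℕ} (h : k % 2 = l % 2) : colorPair k = colorPair l := by
  funext x y; simp [colorPair, h]

/-- The label of slot `j` at `u`. -/
def nodeLabel (M : Model n) (u : Node n) (j : Fin 3) : Fin 3 := slotLabel (M.1.2 u) (M.2.1 u) j

/-- A number with the parity of the column of a vertex. -/
def level (α : Attach n) (u : Node n) : ℕ := (addr α u).length + (bif u.1 then 1 else 0)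

/-- The name of the neighbor through slot `j` together with the color of the joining edge. -/
def edgeInfo (M : Model n) (u : Node n) (j : Fin 3) : Names n × (Fin 3 × Fin 3) :=
  (M.2.2.1 (move M.1.1 u j).1, colorPair (level M.1.1 u) (nodeLabel M u j)
    (nodeLabel M (move M.1.1 u j).1 (move M.1.1 u j).2))

/-- The oracle's answer at a vertex. -/
noncomputable def nodeAnswer (M : Model n) (u : Node n) : Finset (Names n × (Fin 3 × Fin 3)) :=
  (Finset.univ.filter fun j : Fin 3 => addr M.1.1 u ≠ [] ∨ j ≠ 0).image (edgeInfo M u)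

/-- The oracle's answer to a query string. -/
noncomputable def modelAnswer (M : Model n) (x : Names n) : Answer n :=
  if h : ∃ u, M.2.2.1 u = x then some (nodeAnswer M (Classical.choose h)) else none

lemma modelAnswer_name (M : Model n) (u : Node n) :
    modelAnswer M (M.2.2.1 u) = some (nodeAnswer M u) := by
  have h : ∃ v, M.2.2.1 v = M.2.2.1 u := ⟨u, rfl⟩
  rw [modelAnswer, dif_pos h, M.2.2.1.injective (Classical.choose_spec h)]

/-- The transcript of a strategy against an instance. -/
noncomputable def modelTranscript (M : Model n) (A : Strategy n) : ℕ → Transcript n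
  | 0 => []
  | k + 1 => modelTranscript M A k ++
      [(A (modelTranscript M A k), modelAnswer M (A (modelTranscript M A k)))]

/-- The name and the label of the back slot at the end of every walk. -/
def tape (M : Model n) (w : List Bool) : Names n × Fin 3 :=
  (M.2.2.1 (pos M.1.1 M.1.2 w), nodeLabel M (pos M.1.1 M.1.2 w) (back M.1.1 M.1.2 w))

/-- The answer predicted at the end of a walk if all walks end at distinct vertices. -/
noncomputable def predicted (f : List Bool → Names n × Fin 3) (w : List Bool) :
    Finset (Names n × (Fin 3 × Fin 3)) :=
  Finset.univ.image (fun d =>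
      ((f (d :: w)).1, colorPair w.length ((f w).2 + bitSlot d) (f (d :: w)).2)) ∪
    match w with
    | [] => ∅
    | d :: v => {((f v).1, colorPair (v.length + 1) (f (d :: v)).2 ((f v).2 + bitSlot d))}

/-- The vertex of the exploration tree `T` with name `x`. -/
noncomputable def lookup (f : List Bool → Names n × Fin 3) (T : Finset (List Bool)) (x : Names n) :
    Option (List Bool) :=
  if h : ∃ w, w ∈ T ∧ (f w).1 = x then some (Classical.choose h) else none

/-- The exploration tree after visiting a vertex. -/
noncomputable def extend (T : Finset (List Bool)) : Option (List Bool) → Finset (List Bool)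
  | none => T
  | some w => insert (true :: w) (insert (false :: w) T)

/-- The run of a strategy against predicted answers: the transcript and the exploration tree. -/
noncomputable def run (f : List Bool → Names n × Fin 3) (A : Strategy n) :
    ℕ → Transcript n × Finset (List Bool)
  | 0 => ([], {[]})
  | k + 1 =>
    ((run f A k).1 ++ [(A (run f A k).1,
        (lookup f (run f A k).2 (A (run f A k).1)).map (predicted f))],
      extend (run f A k).2 (lookup f (run f A k).2 (A (run f A k).1)))

lemma lookup_eq_some {f : List Bool → Names n × Fin 3} {T : Finset (List Bool)} {x : Names n}
    {w : List Bool} (h : lookup f T x = some w) : w ∈ T ∧ (f w).1 = x := by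
  unfold lookup at h
  split_ifs at h with h'
  obtain rfl := Option.some.inj h
  exact Classical.choose_spec h'

lemma lookup_eq_none {f : List Bool → Names n × Fin 3} {T : Finset (List Bool)} {x : Names n} :
    lookup f T x = none ↔ ∀ w ∈ T, (f w).1 ≠ x := by
  unfold lookup
  split_ifs with h
  · simpa using h
  · simpa using h

lemma lookup_congr {f f' : List Bool → Names n × Fin 3} {T : Finset (List Bool)}
    (h : ∀ w ∈ T, f w = f' w) (x : Names n) : lookup f T x = lookup f' T x := by
  have : (fun w => w ∈ T ∧ (f w).1 = x) = fun w => w ∈ T ∧ (f' w).1 = x := by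
    funext w
    refine propext ⟨fun hw => ⟨hw.1, ?_⟩, fun hw => ⟨hw.1, ?_⟩⟩
    · rw [← h w hw.1]; exact hw.2
    · rw [h w hw.1]; exact hw.2
  unfold lookup
  simp only [this]

lemma subset_extend (T : Finset (List Bool)) (o : Option (List Bool)) : T ⊆ extend T o := by
  cases o with
  | none => exact subset_rfl
  | some w => exact (Finset.subset_insert _ _).trans (Finset.subset_insert _ _)

lemma SuffixClosed.insert {T : Finset (List Bool)} (hT : SuffixClosed T) {d : Bool} {w : List Bool}
    (hw : w ∈ T) : SuffixClosed (insert (d :: w) T) where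
  nil_mem := Finset.mem_insert_of_mem hT.nil_mem
  tail_mem d' w' h := by
    apply Finset.mem_insert_of_mem
    rcases Finset.mem_insert.1 h with h | h
    · obtain ⟨-, rfl⟩ := List.cons.inj h; exact hw
    · exact hT.tail_mem _ _ h

lemma run_suffixClosed (f : List Bool → Names n × Fin 3) (A : Strategy n) :
    ∀ k, SuffixClosed (run f A k).2
  | 0 => ⟨by simp [run], by simp [run]⟩
  | k + 1 => by
    have ih := run_suffixClosed f A k
    simp only [run]
    rcases h : lookup f (run f A k).2 (A (run f A k).1) with _ | w
    · exact ih
    · have hw := (lookup_eq_some h).1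
      exact (ih.insert hw).insert (Finset.mem_insert_of_mem hw)

lemma run_length_le (f : List Bool → Names n × Fin 3) (A : Strategy n) :
    ∀ k, ∀ w ∈ (run f A k).2, w.length ≤ k
  | 0 => by simp [run]
  | k + 1 => by
    have ih := run_length_le f A k
    simp only [run]
    rcases h : lookup f (run f A k).2 (A (run f A k).1) with _ | w
    · exact fun w hw => (ih w hw).trans (Nat.le_succ _)
    · have hw := ih w (lookup_eq_some h).1
      intro v hv
      simp only [extend, Finset.mem_insert] at hv
      rcases hv with rfl | rfl | hv
      · simpa using hw
      · simpa using hw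
      · exact (ih v hv).trans (Nat.le_succ _)

lemma card_run_le (f : List Bool → Names n × Fin 3) (A : Strategy n) :
    ∀ k, (run f A k).2.card ≤ 2 * k + 1
  | 0 => by simp [run]
  | k + 1 => by
    have ih := card_run_le f A k
    simp only [run]
    rcases h : lookup f (run f A k).2 (A (run f A k).1) with _ | w
    · simp only [extend]; omega
    · have h1 := Finset.card_insert_le (true :: w) (insert (false :: w) (run f A k).2)
      have h2 := Finset.card_insert_le (false :: w) (run f A k).2
      simp only [extend]; omega

lemma predicted_congr {f f' : List Bool → Names n × Fin 3} {T : Finset (List Bool)}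
    (hT : SuffixClosed T) {w : List Bool} (hw : w ∈ T)
    (h : ∀ v ∈ extend T (some w), f v = f' v) : predicted f w = predicted f' w := by
  have hsub := subset_extend T (some w)
  have h0 := h w (hsub hw)
  have hd : ∀ d, f (d :: w) = f' (d :: w) := by
    rintro (_ | _)
    · exact h _ (by simp [extend])
    · exact h _ (by simp [extend])
  unfold predicted
  congr 1
  · simp only [h0, hd]
  · cases w with
    | nil => rfl
    | cons d v => simp only [h0, h v (hsub (hT.tail_mem _ _ hw))]

/-- The run only depends on the part of the tape it has explored. -/
lemma run_congr {f f' : List Bool → Names n × Fin 3} (A : Strategy n) :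
    ∀ k, (∀ w ∈ (run f A k).2, f w = f' w) → run f' A k = run f A k
  | 0, _ => rfl
  | k + 1, h => by
    have hsub : (run f A k).2 ⊆ (run f A (k + 1)).2 := subset_extend _ _
    have ih := run_congr A k fun w hw => h w (hsub hw)
    have hl : lookup f' (run f A k).2 (A (run f A k).1) =
        lookup f (run f A k).2 (A (run f A k).1) :=
      (lookup_congr (fun w hw => h w (hsub hw)) _).symm
    simp only [run, ih, hl]
    simp only [run] at h
    congr 4
    rcases ho : lookup f (run f A k).2 (A (run f A k).1) with _ | w
    · rfl
    · rw [ho] at h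
      simp only [Option.map_some]
      rw [predicted_congr (run_suffixClosed f A k) (lookup_eq_some ho).1 h]

/-- The next exploration tree is determined by the explored part of the tape. -/
lemma run_succ_congr {f f' : List Bool → Names n × Fin 3} (A : Strategy n) (k : ℕ)
    (h : ∀ w ∈ (run f A k).2, f w = f' w) : (run f' A (k + 1)).2 = (run f A (k + 1)).2 := by
  simp only [run, run_congr A k h, lookup_congr h]

lemma exists_turn : ∀ (e : Bool) (b j : Fin 3), j ≠ b → ∃ d, b + turn e d = j := by decide

lemma exists_outSlot (α : Attach n) (ε : Node n → Bool) (w : List Bool) {j : Fin 3}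
    (h : j ≠ back α ε w) : ∃ d, outSlot α ε w d = j := exists_turn _ _ _ h

lemma level_move (α : Attach n) (u : Node n) (j : Fin 3) (h : addr α u ≠ [] ∨ j ≠ 0) :
    level α (move α u j).1 % 2 = (level α u + 1) % 2 := by
  by_cases hj : j = 0
  · subst hj
    obtain ⟨b, p, hp⟩ := List.exists_cons_of_ne_nil (h.resolve_right (by simp))
    have hl := length_addr_le α u
    rw [hp, List.length_cons] at hl
    rw [move_zero α hp, level, level, addr_nodeAt α _ (by omega), fst_nodeAt, hp, List.length_cons]
    omega
  · by_cases hc : OnCycle u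
    · obtain ⟨s, p | i⟩ := u
      · simp [OnCycle] at hc
      · rw [move_cross α s i hj]
        simp only [level, addr, (α _ _).2]
        cases s <;> simp only [Bool.not_false, Bool.not_true, cond_true, cond_false] <;> omega
    · have hl := (not_onCycle_iff α u).1 hc
      rw [move_down α hc hj, level, level, addr_nodeAt α _ (by simpa using hl), fst_nodeAt,
        List.length_cons]
      omega

section
variable {m K : ℕ} {T : Finset (List Bool)} {M : Model n}

lemma Good.addr_ne_nil_or (hm : 0 < m) (hmn : m < n) {α : Attach n} {ε : Node n → Bool}
    (G : Good m K α ε T) (hT : SuffixClosed T) {w : List Bool} (hw : w ∈ T) (d : Bool) :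
    addr α (pos α ε w) ≠ [] ∨ outSlot α ε w d ≠ 0 := by
  by_cases h : w = []
  · right; subst h
    have := outSlot_ne_back α ε [] d
    rwa [back_nil] at this
  · left; exact G.addr_ne_nil hm hmn hT hw h

lemma Good.level_pos (hm : 0 < m) (hmn : m < n) {α : Attach n} {ε : Node n → Bool}
    (G : Good m K α ε T) (hT : SuffixClosed T) : ∀ w ∈ T, level α (pos α ε w) % 2 = w.length % 2
  | [], _ => by simp [pos_nil, level, addr_root (show 0 < n by omega)]
  | d :: w, h => by
    have hw := hT.tail_mem _ _ h
    have ih := G.level_pos hm hmn hT w hw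
    rw [pos_cons, level_move _ _ _ (G.addr_ne_nil_or hm hmn hT hw d), List.length_cons]
    omega

lemma nodeLabel_outSlot (M : Model n) (w : List Bool) (d : Bool) :
    nodeLabel M (pos M.1.1 M.1.2 w) (outSlot M.1.1 M.1.2 w d) = (tape M w).2 + bitSlot d :=
  slotLabel_add_turn _ _ _ _

/-- On good sets of words the oracle behaves as predicted by its tape. -/
lemma Good.nodeAnswer_eq (hm : 0 < m) (hmn : m < n) (G : Good m K M.1.1 M.1.2 T)
    (hT : SuffixClosed T) {w : List Bool} (hw : w ∈ T) :
    nodeAnswer M (pos M.1.1 M.1.2 w) = predicted (tape M) w := by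
  have hcol := colorPair_congr (G.level_pos hm hmn hT w hw)
  have hout : ∀ d, edgeInfo M (pos M.1.1 M.1.2 w) (outSlot M.1.1 M.1.2 w d) =
      ((tape M (d :: w)).1,
        colorPair w.length ((tape M w).2 + bitSlot d) (tape M (d :: w)).2) := by
    intro d
    rw [edgeInfo, hcol, nodeLabel_outSlot]
    rfl
  cases w with
  | nil =>
    ext x
    simp only [nodeAnswer, predicted, Finset.mem_image, Finset.mem_filter, Finset.mem_univ,
      true_and, Finset.union_empty]
    have ha : addr M.1.1 (pos M.1.1 M.1.2 []) = [] := by rw [pos_nil, addr_root (by omega)]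
    constructor
    · rintro ⟨j, hj, rfl⟩
      obtain ⟨d, rfl⟩ := exists_outSlot M.1.1 M.1.2 [] (j := j) (by simpa [ha, back_nil] using hj)
      exact ⟨d, (hout d).symm⟩
    · rintro ⟨d, rfl⟩
      exact ⟨_, G.addr_ne_nil_or hm hmn hT hw d, hout d⟩
  | cons d v =>
    have hne := G.addr_ne_nil hm hmn hT hw (by simp)
    have hback : edgeInfo M (pos M.1.1 M.1.2 (d :: v)) (back M.1.1 M.1.2 (d :: v)) =
        ((tape M v).1, colorPair (v.length + 1) (tape M (d :: v)).2
          ((tape M v).2 + bitSlot d)) := by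
      rw [edgeInfo, hcol, G.move_back hm hmn hT d (hT.tail_mem _ _ hw), nodeLabel_outSlot]
      rfl
    ext x
    simp only [nodeAnswer, predicted, Finset.mem_image, Finset.mem_filter, Finset.mem_univ,
      true_and, Finset.mem_union, Finset.mem_singleton]
    constructor
    · rintro ⟨j, -, rfl⟩
      by_cases hj : j = back M.1.1 M.1.2 (d :: v)
      · right; rw [hj, hback]
      · left
        obtain ⟨d', rfl⟩ := exists_outSlot M.1.1 M.1.2 (d :: v) hj
        exact ⟨d', (hout d').symm⟩
    · rintro (⟨d', rfl⟩ | rfl)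
      · exact ⟨_, Or.inl hne, hout d'⟩
      · exact ⟨_, Or.inl hne, hback⟩

end

/-- The strategy queries the name of a vertex that it has not explored. -/
def LuckyGuess (M : Model n) (f : List Bool → Names n × Fin 3) (A : Strategy n) (k : ℕ) : Prop :=
  (∀ w ∈ (run f A k).2, (f w).1 ≠ A (run f A k).1) ∧ ∃ u, M.2.2.1 u = A (run f A k).1

/-- Without lucky guesses and spoiled sets the transcript is the predicted one. -/
lemma modelTranscript_eq {m K : ℕ} (hm : 0 < m) (hmn : m < n) {M : Model n} {A : Strategy n} :
    ∀ {k : ℕ}, (∀ j < k, Good m K M.1.1 M.1.2 (run (tape M) A j).2) →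
      (∀ j < k, ¬ LuckyGuess M (tape M) A j) →
      modelTranscript M A k = (run (tape M) A k).1
  | 0, _, _ => rfl
  | k + 1, hG, hL => by
    have ih := modelTranscript_eq (k := k) hm hmn (fun j hj => hG j (by omega))
      (fun j hj => hL j (by omega))
    have G := hG k (Nat.lt_succ_self k)
    have L := hL k (Nat.lt_succ_self k)
    simp only [modelTranscript, run, ih]
    congr 3
    rcases ho : lookup (tape M) (run (tape M) A k).2 (A (run (tape M) A k).1) with _ | w
    · have h1 := lookup_eq_none.1 ho
      have h2 : ¬ ∃ u, M.2.2.1 u = A (run (tape M) A k).1 := fun h2 => L ⟨h1, h2⟩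
      rw [modelAnswer, dif_neg h2]; rfl
    · obtain ⟨hw, hx⟩ := lookup_eq_some ho
      rw [← hx, Option.map_some, ← G.nodeAnswer_eq hm hmn (run_suffixClosed _ _ _) hw]
      exact modelAnswer_name M _

/-- The strategy finds the right root. -/
def ModelWins (M : Model n) (A : Strategy n) (q : ℕ) : Prop :=
  ∃ k < q, A (modelTranscript M A k) = M.2.2.1 (root n true)

/-- A winning strategy makes a lucky guess or spoils a good set. -/
lemma ModelWins.exists_event {m K : ℕ} (hm : 0 < m) (hmn : m < n) {M : Model n} {A : Strategy n}
    {q : ℕ} (hW : ModelWins M A q) :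
    ∃ k < q, Good m K M.1.1 M.1.2 (run (tape M) A k).2 ∧
      (LuckyGuess M (tape M) A k ∨ ¬ Good m K M.1.1 M.1.2 (run (tape M) A (k + 1)).2) := by
  by_contra! H
  obtain ⟨k, hk, hx⟩ := hW
  have hG : ∀ j ≤ k, Good m K M.1.1 M.1.2 (run (tape M) A j).2 := by
    intro j
    induction j with
    | zero => exact fun _ => good_of_short (by omega) (by simp [run]; omega)
    | succ j ih => exact fun hj => (H j (by omega) (ih (by omega))).2
  have hL : ∀ j ≤ k, ¬ LuckyGuess M (tape M) A j := fun j hj => (H j (by omega) (hG j hj)).1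
  rw [modelTranscript_eq hm hmn (fun j hj => hG j hj.le) (fun j hj => hL j hj.le)] at hx
  apply hL k le_rfl
  refine ⟨fun w hw he => ?_, _, hx.symm⟩
  rw [hx] at he
  have hp : pos M.1.1 M.1.2 w = root n true := M.2.2.1.injective he
  by_cases hw0 : w = []
  · subst hw0
    have := congrArg Prod.fst hp
    simp [pos_nil] at this
  · apply (hG k le_rfl).addr_ne_nil hm hmn (run_suffixClosed _ _ _) hw hw0
    rw [hp, addr_root (by omega)]

/-! ### Oracle instances as models -/

/-- The root-last address of a vertex. -/
def path (u : Vertex n) : List Bool := (List.ofFn u.2.2).reverse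

@[simp] lemma length_path (u : Vertex n) : (path u).length = depth u := by simp [path, depth]

lemma depth_le (u : Vertex n) : depth u ≤ n := Nat.lt_succ_iff.1 u.2.1.2

lemma vertex_ext {u v : Vertex n} (h : u.1 = v.1) (h' : path u = path v) : u = v := by
  obtain ⟨s, ⟨j, hj⟩, f⟩ := u
  obtain ⟨t, ⟨k, hk⟩, g⟩ := v
  have hl : j = k := by simpa [depth] using congrArg List.length h'
  subst hl
  have hfg : f = g := List.ofFn_injective (List.reverse_injective h')
  subst hfg
  obtain rfl : s = t := h
  rfl

lemma exists_path_eq (s : Bool) {p : List Bool} (hp : p.length ≤ n) :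
    ∃ u : Vertex n, u.1 = s ∧ path u = p :=
  ⟨(s, ⟨⟨p.length, Nat.lt_succ_of_le hp⟩, fun i => p.reverse.get (i.cast (by simp))⟩), rfl, by
    conv_rhs => rw [← List.reverse_reverse p]
    refine congrArg List.reverse ?_
    apply List.ext_getElem <;> simp⟩

lemma childOf_iff {u v : Vertex n} :
    childOf v u ↔ v.1 = u.1 ∧ ∃ b, path v = b :: path u := by
  obtain ⟨s, ⟨j, hj⟩, f⟩ := u
  obtain ⟨t, ⟨k, hk⟩, g⟩ := v
  constructor
  · rintro ⟨hs, hd, h⟩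
    refine ⟨hs, ?_⟩
    simp only at hd
    subst hd
    refine ⟨g (Fin.last j), ?_⟩
    simp only at h
    simp only [path, List.ofFn_succ', List.concat_eq_append, List.reverse_append,
      List.reverse_singleton, List.singleton_append, List.cons.injEq, true_and]
    congr 2
    funext i
    exact h i
  · rintro ⟨hs, b, h⟩
    have hl : k = j + 1 := by simpa [depth] using congrArg List.length h
    subst hl
    refine ⟨hs, rfl, fun i => ?_⟩
    simp only [path, List.ofFn_succ', List.concat_eq_append, List.reverse_append,
      List.reverse_singleton, List.singleton_append, List.cons.injEq] at h
    exact congrFun (List.ofFn_injective (List.reverse_injective h.2)) i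

lemma slot_child (σ τ : Fin (2 ^ n) ≃ (Fin n → Bool)) {u v : Vertex n} (hs : v.1 = u.1) {b : Bool}
    (h : path v = b :: path u) : slot σ τ u v = bitSlot b ∧ slot σ τ v u = 0 := by
  have hd : depth v = depth u + 1 := by simpa using congrArg List.length h
  constructor
  · rw [slot, if_pos hs.symm, dif_pos (by omega)]
    have hb : v.2.2 ⟨depth u, by change depth u < depth v; omega⟩ = b := by
      obtain ⟨s, ⟨j, hj⟩, f⟩ := u
      obtain ⟨t, ⟨k, hk⟩, g⟩ := v
      simp only [depth] at hd
      subst hd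
      simp only [path, List.ofFn_succ', List.concat_eq_append, List.reverse_append,
        List.reverse_singleton, List.singleton_append, List.cons.injEq] at h
      exact h.1
    simp only [hb]
    cases b <;> rfl
  · rw [slot, if_pos hs, dif_neg (by omega)]

/-- Bit strings of length `n` as leaf addresses. -/
def leafEquiv (n : ℕ) : (Fin n → Bool) ≃ Leaf n where
  toFun f := ⟨(List.ofFn f).reverse, by simp⟩
  invFun p i := p.1.reverse.get (i.cast (by simp [p.2]))
  left_inv f := by funext i; simp
  right_inv p := by
    obtain ⟨p, rfl⟩ := p
    apply Subtype.ext
    simp only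
    conv_rhs => rw [← List.reverse_reverse p]
    congr 1
    apply List.ext_getElem <;> simp

lemma leafEquiv_leafPath {u : Vertex n} (h : depth u = n) :
    (leafEquiv n (leafPath u)).1 = path u := by
  obtain ⟨s, ⟨j, hj⟩, f⟩ := u
  obtain rfl : j = n := h
  simp only [leafEquiv, path, Equiv.coe_fn_mk]
  congr 2
  funext i
  simp [leafPath, depth]

/-- The positions of the leaves on the cycle. -/
def attachOf (σ τ : Fin (2 ^ n) ≃ (Fin n → Bool)) : Attach n :=
  fun s => (bif s then τ else σ).trans (leafEquiv n)

/-- The node corresponding to a vertex. -/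
def toNode (α : Attach n) (u : Vertex n) : Node n := nodeAt α u.1 (path u)

@[simp] lemma toNode_fst (α : Attach n) (u : Vertex n) : (toNode α u).1 = u.1 := fst_nodeAt _ _ _

@[simp] lemma addr_toNode (α : Attach n) (u : Vertex n) : addr α (toNode α u) = path u :=
  addr_nodeAt α _ (by simpa using depth_le u)

lemma toNode_bijective (α : Attach n) : Function.Bijective (toNode α) := by
  constructor
  · intro u v h
    exact vertex_ext (by rw [← toNode_fst α u, h, toNode_fst]) (by
      rw [← addr_toNode α u, h, addr_toNode])
  · intro w
    obtain ⟨u, h, h'⟩ := exists_path_eq w.1 (length_addr_le α w)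
    exact ⟨u, by rw [toNode, h, h', nodeAt_addr]⟩

lemma toNode_entrance (hn : 0 < n) (α : Attach n) : toNode α (entrance n) = root n false := by
  simp [toNode, entrance, path, nodeAt, root, hn]

lemma toNode_exitVertex (hn : 0 < n) (α : Attach n) :
    toNode α (exitVertex n) = root n true := by
  simp [toNode, exitVertex, path, nodeAt, root, hn]

lemma toNode_eq_inr_iff (σ τ : Fin (2 ^ n) ≃ (Fin n → Bool)) (u : Vertex n) (s : Bool)
    (i : Fin (2 ^ n)) : toNode (attachOf σ τ) u = (s, .inr i) ↔
      u.1 = s ∧ depth u = n ∧ (bif s then τ else σ) i = leafPath u := by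
  constructor
  · intro h
    have hs : u.1 = s := by rw [← toNode_fst (attachOf σ τ), h]
    have ha : path u = ((attachOf σ τ) s i).1 := by
      rw [← addr_toNode (attachOf σ τ), h]; rfl
    have hd : depth u = n := by rw [← length_path, ha]; exact ((attachOf σ τ) s i).2
    refine ⟨hs, hd, (leafEquiv n).injective (Subtype.ext ?_)⟩
    rw [leafEquiv_leafPath hd, ha]; rfl
  · rintro ⟨hs, hd, h⟩
    refine node_ext (attachOf σ τ) (by simp [hs]) ?_
    rw [addr_toNode, ← leafEquiv_leafPath hd, ← h]; rfl

lemma adj_symm {σ τ : Fin (2 ^ n) ≃ (Fin n → Bool)} {u v : Vertex n} (h : adj σ τ u v) :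
    adj σ τ v u := by
  unfold adj at *; tauto

lemma sub_one_ne (hn : 0 < n) (i : Fin (2 ^ n)) : i - 1 ≠ i := by
  simp [hn.ne']

lemma cross_edge (hn : 0 < n) {σ τ : Fin (2 ^ n) ≃ (Fin n → Bool)} {u v : Vertex n}
    {i : Fin (2 ^ n)} {j : Fin 3} (hj : j ≠ 0)
    (hu : toNode (attachOf σ τ) u = (false, .inr i))
    (hv : toNode (attachOf σ τ) v = (true, .inr (crossIndex false j i))) :
    adj σ τ u v ∧ slot σ τ u v = j ∧ slot σ τ v u = j := by
  obtain ⟨hus, hud, hui⟩ := (toNode_eq_inr_iff _ _ _ _ _).1 hu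
  obtain ⟨hvs, hvd, hvi⟩ := (toNode_eq_inr_iff _ _ _ _ _).1 hv
  simp only [cond_false, cond_true] at hui hvi
  have h3 : j = 1 ∨ j = 2 := by clear hv hvi; revert j; decide
  refine ⟨Or.inr (Or.inr (Or.inl ⟨hus, hvs, hud, hvd, i, hui, ?_⟩)), ?_, ?_⟩
  · rcases h3 with rfl | rfl
    · left; simpa [crossIndex] using hvi
    · right; simpa [crossIndex] using hvi
  · rw [slot, if_neg (by simp [hus, hvs]), if_pos hus, ← hui, ← hvi]
    rcases h3 with rfl | rfl
    · simp [crossIndex]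
    · simp [crossIndex, (sub_one_ne hn i).symm]
  · rw [slot, if_neg (by simp [hus, hvs]), if_neg (by simp [hvs]), ← hui, ← hvi]
    rcases h3 with rfl | rfl
    · simp [crossIndex]
    · simp [crossIndex, sub_one_ne hn i]

lemma adj_of_move (hn : 0 < n) {σ τ : Fin (2 ^ n) ≃ (Fin n → Bool)} {u v : Vertex n} {j : Fin 3}
    (hj : path u ≠ [] ∨ j ≠ 0)
    (h : (move (attachOf σ τ) (toNode (attachOf σ τ) u) j).1 = toNode (attachOf σ τ) v) :
    adj σ τ u v ∧ slot σ τ u v = j ∧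
      slot σ τ v u = (move (attachOf σ τ) (toNode (attachOf σ τ) u) j).2 := by
  set α := attachOf σ τ with hα
  by_cases hj0 : j = 0
  · subst hj0
    obtain ⟨b, p, hp⟩ := List.exists_cons_of_ne_nil (hj.resolve_right (by simp))
    have hm := move_zero α (u := toNode α u) (by rw [addr_toNode, hp])
    rw [hm] at h ⊢
    have hl : p.length ≤ n := by
      have := depth_le u
      rw [← length_path, hp, List.length_cons] at this
      omega
    have hs : u.1 = v.1 := by
      have := congrArg Prod.fst h
      simpa using this
    have hv : path v = p := by rw [← addr_toNode α v, ← h, addr_nodeAt α _ hl]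
    rw [← hv] at hp
    have := slot_child σ τ hs hp
    exact ⟨Or.inl (childOf_iff.2 ⟨hs, b, hp⟩), this.2, this.1⟩
  · by_cases hc : OnCycle (toNode α u)
    · rcases ho : toNode α u with ⟨s, p | i⟩
      · simp [OnCycle, ho] at hc
      · rw [ho, move_cross α s i hj0] at h
        rw [move_cross α s i hj0]
        cases s
        · exact cross_edge hn hj0 ho h.symm
        · obtain ⟨h1, h2, h3⟩ := cross_edge hn hj0 h.symm (by
            rw [show crossIndex false j (crossIndex true j i) = i from
              crossIndex_crossIndex true j i]
            exact ho)
          exact ⟨adj_symm h1, h3, h2⟩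
    · have hl := (not_onCycle_iff α _).1 hc
      rw [move_down α hc hj0] at h ⊢
      have hs : v.1 = u.1 := by
        have := congrArg Prod.fst h
        simpa using this.symm
      have hv : path v = (j == 2) :: path u := by
        rw [← addr_toNode α v, ← h, addr_nodeAt α _ (by simpa using hl), addr_toNode]
      have := slot_child σ τ hs hv
      rw [bitSlot_of_ne_zero j hj0] at this
      exact ⟨Or.inr (Or.inl (childOf_iff.2 ⟨hs, _, hv⟩)), this⟩

lemma exists_move_of_cycleAdj {σ τ : Fin (2 ^ n) ≃ (Fin n → Bool)} {u v : Vertex n}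
    (h : cycleAdj σ τ u v) : ∃ j i, j ≠ 0 ∧ toNode (attachOf σ τ) u = (false, .inr i) ∧
      toNode (attachOf σ τ) v = (true, .inr (crossIndex false j i)) := by
  obtain ⟨hus, hvs, hud, hvd, i, hi, h | h⟩ := h
  · exact ⟨1, i, by decide, (toNode_eq_inr_iff _ _ _ _ _).2 ⟨hus, hud, hi⟩,
      (toNode_eq_inr_iff _ _ _ _ _).2 ⟨hvs, hvd, by simpa [crossIndex] using h⟩⟩
  · exact ⟨2, i, by decide, (toNode_eq_inr_iff _ _ _ _ _).2 ⟨hus, hud, hi⟩,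
      (toNode_eq_inr_iff _ _ _ _ _).2 ⟨hvs, hvd, by simpa [crossIndex] using h⟩⟩

lemma exists_move_of_adj {σ τ : Fin (2 ^ n) ≃ (Fin n → Bool)} {u v : Vertex n}
    (h : adj σ τ u v) : ∃ j, (path u ≠ [] ∨ j ≠ 0) ∧
      (move (attachOf σ τ) (toNode (attachOf σ τ) u) j).1 = toNode (attachOf σ τ) v := by
  set α := attachOf σ τ with hα
  rcases h with h | h | h | h
  · obtain ⟨hs, b, hp⟩ := childOf_iff.1 h
    refine ⟨0, Or.inl (by simp [hp]), ?_⟩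
    rw [move_zero α (by rw [addr_toNode, hp]), toNode_fst, hs]
    rfl
  · obtain ⟨hs, b, hp⟩ := childOf_iff.1 h
    refine ⟨bitSlot b, Or.inr (bitSlot_ne_zero b), ?_⟩
    have hc : ¬ OnCycle (toNode α u) := by
      rw [not_onCycle_iff α, addr_toNode]
      have := depth_le v
      rw [← length_path, hp, List.length_cons] at this
      omega
    rw [move_down α hc (bitSlot_ne_zero b), bitSlot_beq_two, addr_toNode, toNode_fst, ← hs, ← hp]
    rfl
  · obtain ⟨j, i, hj, hu, hv⟩ := exists_move_of_cycleAdj h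
    refine ⟨j, Or.inr hj, ?_⟩
    rw [hu, hv, move_cross α _ _ hj]; rfl
  · obtain ⟨j, i, hj, hv, hu⟩ := exists_move_of_cycleAdj h
    refine ⟨j, Or.inr hj, ?_⟩
    rw [hu, hv, move_cross α _ _ hj]
    simp only [Bool.not_true]
    rw [show crossIndex true j (crossIndex false j i) = i from crossIndex_crossIndex false j i]

/-- The permutation of slots with a given orientation and offset. -/
noncomputable def slotPerm (x : Bool × Fin 3) : Equiv.Perm (Fin 3) :=
  Equiv.ofBijective (slotLabel x.1 x.2) (by revert x; decide)

lemma slotPerm_bijective : Function.Bijective slotPerm := by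
  rw [Fintype.bijective_iff_injective_and_card]
  constructor
  · have key : ∀ x y : Bool × Fin 3, slotLabel x.1 x.2 0 = slotLabel y.1 y.2 0 →
        slotLabel x.1 x.2 1 = slotLabel y.1 y.2 1 → x = y := by decide
    exact fun x y h => key x y (congrArg (fun p => p 0) h) (congrArg (fun p => p 1) h)
  · simp [Fintype.card_perm, Nat.factorial]

/-- The correspondence between vertices and nodes. -/
noncomputable def nodeEquiv (α : Attach n) : Vertex n ≃ Node n :=
  Equiv.ofBijective (toNode α) (toNode_bijective α)

/-- Pairs of cycle orders as leaf positions. -/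
def attachEquiv (n : ℕ) :
    (Fin (2 ^ n) ≃ (Fin n → Bool)) × (Fin (2 ^ n) ≃ (Fin n → Bool)) ≃ Attach n where
  toFun x := attachOf x.1 x.2
  invFun α := ((α false).trans (leafEquiv n).symm, (α true).trans (leafEquiv n).symm)
  left_inv x := by
    ext <;> simp [attachOf]
  right_inv α := by
    funext s
    cases s <;> ext <;> simp [attachOf]

/-- Oracle instances are models. -/
noncomputable def paramEquiv (hn : 0 < n) : Param n ≃ Model n :=
  (Equiv.prodShear (attachEquiv n) fun x =>
    Equiv.prodCongr
      ((Equiv.arrowCongr (nodeEquiv (attachOf x.1 x.2))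
        (Equiv.ofBijective slotPerm slotPerm_bijective).symm).trans
          (Equiv.arrowProdEquivProdArrow (Node n) (fun _ => Bool) (fun _ => Fin 3)))
      ((Equiv.embeddingCongr (nodeEquiv (attachOf x.1 x.2)) (Equiv.refl (Names n))).subtypeEquiv
        fun ν => by
          have : (nodeEquiv (attachOf x.1 x.2)).symm (root n false) = entrance n := by
            rw [Equiv.symm_apply_eq]; exact (toNode_entrance hn _).symm
          simp [Equiv.embeddingCongr, this])).trans
    ((Equiv.prodCongr (Equiv.refl _) (Equiv.prodAssoc _ _ _)).trans (Equiv.prodAssoc _ _ _).symm)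

section
variable (hn : 0 < n) (P : Param n)

lemma paramEquiv_attach : (paramEquiv hn P).1.1 = attachOf P.1.1 P.1.2 := rfl

lemma paramEquiv_name (u : Vertex n) :
    (paramEquiv hn P).2.2.1 (toNode (attachOf P.1.1 P.1.2) u) = P.2.2.1 u := by
  change P.2.2.1 ((nodeEquiv (attachOf P.1.1 P.1.2)).symm
    ((nodeEquiv (attachOf P.1.1 P.1.2)) u)) = _
  rw [Equiv.symm_apply_apply]

lemma paramEquiv_label (u : Vertex n) (j : Fin 3) :
    nodeLabel (paramEquiv hn P) (toNode (attachOf P.1.1 P.1.2) u) j = P.2.1 u j := by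
  set e := Equiv.ofBijective slotPerm slotPerm_bijective with he
  change slotPerm (e.symm (P.2.1 ((nodeEquiv (attachOf P.1.1 P.1.2)).symm
    ((nodeEquiv (attachOf P.1.1 P.1.2)) u)))) j = _
  rw [Equiv.symm_apply_apply]
  exact congrArg (fun p => p j) (e.apply_symm_apply (P.2.1 u))

lemma level_toNode (α : Attach n) (u : Vertex n) : level α (toNode α u) % 2 = col u % 2 := by
  have := depth_le u
  rw [level, addr_toNode, toNode_fst, length_path, col]
  cases u.1 <;> simp <;> omega

lemma paramEquiv_edgeInfo {u v : Vertex n} {j : Fin 3} (hj : path u ≠ [] ∨ j ≠ 0)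
    (h : (move (attachOf P.1.1 P.1.2) (toNode (attachOf P.1.1 P.1.2) u) j).1 =
      toNode (attachOf P.1.1 P.1.2) v) :
    edgeInfo (paramEquiv hn P) (toNode (attachOf P.1.1 P.1.2) u) j =
      (P.2.2.1 v, ecolor P.1.1 P.1.2 P.2.1 u v) := by
  obtain ⟨-, h1, h2⟩ := adj_of_move hn hj h
  rw [edgeInfo, paramEquiv_attach, h, ← h2, paramEquiv_name, paramEquiv_label, paramEquiv_label,
    colorPair_congr (level_toNode _ u), ecolor, h1, colorPair]

lemma paramEquiv_answer (x : Names n) : modelAnswer (paramEquiv hn P) x = answer P x := by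
  unfold answer
  split_ifs with h
  · set u := Classical.choose h with hu
    rw [← show P.2.2.1 u = x from Classical.choose_spec h, ← paramEquiv_name hn P,
      modelAnswer_name, Option.some.injEq]
    ext y
    simp only [nodeAnswer, paramEquiv_attach, addr_toNode, Finset.mem_image, Finset.mem_filter,
      Finset.mem_univ, true_and]
    constructor
    · rintro ⟨j, hj, rfl⟩
      obtain ⟨v, hv⟩ := (toNode_bijective (attachOf P.1.1 P.1.2)).2
        (move (attachOf P.1.1 P.1.2) (toNode (attachOf P.1.1 P.1.2) u) j).1
      exact ⟨v, (adj_of_move hn hj hv.symm).1, (paramEquiv_edgeInfo hn P hj hv.symm).symm⟩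
    · rintro ⟨v, hv, rfl⟩
      obtain ⟨j, hj, hv'⟩ := exists_move_of_adj hv
      exact ⟨j, hj, paramEquiv_edgeInfo hn P hj hv'⟩
  · rw [modelAnswer, dif_neg]
    rintro ⟨w, hw⟩
    obtain ⟨u, rfl⟩ := (toNode_bijective (attachOf P.1.1 P.1.2)).2 w
    exact h ⟨u, (paramEquiv_name hn P u).symm.trans hw⟩

lemma paramEquiv_transcript (A : Strategy n) (k : ℕ) :
    modelTranscript (paramEquiv hn P) A k = transcript P A k := by
  induction k with
  | zero => rfl
  | succ k ih => simp only [modelTranscript, transcript, ih, paramEquiv_answer]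

lemma modelWins_paramEquiv (A : Strategy n) (q : ℕ) :
    ModelWins (paramEquiv hn P) A q ↔ Wins P A q := by
  simp only [ModelWins, Wins, paramEquiv_transcript, ← paramEquiv_name hn P,
    toNode_exitVertex hn]

end

/-! ### Counting the instances with a prescribed tape -/

lemma card_agree_mul {ι B : Type*} [Fintype ι] [Fintype B] (S : Finset ι) (g : ι → B) :
    (Finset.univ.filter fun f : ι → B => ∀ i ∈ S, f i = g i).card * Fintype.card B ^ S.card =
      Fintype.card B ^ Fintype.card ι := by
  have h : (Finset.univ.filter fun f : ι → B => ∀ i ∈ S, f i = g i) =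
      Fintype.piFinset fun i => if i ∈ S then {g i} else Finset.univ := by
    ext f
    simp only [Finset.mem_filter, Finset.mem_univ, true_and, Fintype.mem_piFinset]
    refine forall_congr' fun i => ?_
    split_ifs with hi <;> simp [hi]
  have hc : ∀ i, (if i ∈ S then {g i} else Finset.univ : Finset B).card =
      if i ∈ S then 1 else Fintype.card B := fun i => by split_ifs <;> simp
  rw [h, Fintype.card_piFinset, Finset.prod_congr rfl fun i _ => hc i, Finset.prod_ite]
  simp only [Finset.prod_const, one_pow, one_mul]
  have hS := Finset.card_filter_add_card_filter_not (s := (Finset.univ : Finset ι)) (· ∈ S)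
  rw [Finset.filter_mem_eq_inter, Finset.univ_inter, Finset.card_univ] at hS
  rw [← pow_add, ← hS, add_comm]

/-- Namings of the nodes. -/
abbrev Naming (n : ℕ) := {ν : Node n ↪ Names n // ν (root n false) = fun _ => false}

/-- A name given to a further vertex can be exchanged for any other unused name. -/
lemma card_naming_eq_mul_le {S : Finset (Node n)} (h0 : root n false ∈ S) (g : Node n → Names n)
    {u : Node n} (hu : u ∉ S) (x : Names n) :
    (Finset.univ.filter fun ν : Naming n => (∀ v ∈ S, ν.1 v = g v) ∧ ν.1 u = x).card *
        (Fintype.card (Names n) - S.card) ≤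
      (Finset.univ.filter fun ν : Naming n => ∀ v ∈ S, ν.1 v = g v).card := by
  have hY : Fintype.card (Names n) - S.card ≤ ((S.image g)ᶜ).card := by
    rw [Finset.card_compl]
    have := Finset.card_image_le (s := S) (f := g)
    omega
  refine (Nat.mul_le_mul_left _ hY).trans ?_
  rw [← Finset.card_product]
  have hfix : ∀ p ∈ (Finset.univ.filter fun ν : Naming n => (∀ v ∈ S, ν.1 v = g v) ∧ ν.1 u = x) ×ˢ
      (S.image g)ᶜ, ∀ v ∈ S, Equiv.swap x p.2 (p.1.1 v) = p.1.1 v := by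
    rintro ⟨ν, y⟩ hp v hv
    simp only [Finset.mem_product, Finset.mem_filter, Finset.mem_univ, true_and,
      Finset.mem_compl, Finset.mem_image, not_exists, not_and] at hp
    obtain ⟨⟨h1, h2⟩, h3⟩ := hp
    apply Equiv.swap_apply_of_ne_of_ne
    · rw [← h2]
      exact fun h => hu (ν.1.injective h ▸ hv)
    · rw [h1 v hv]
      exact h3 v hv
  have hroot : ∀ p ∈ (Finset.univ.filter fun ν : Naming n => (∀ v ∈ S, ν.1 v = g v) ∧ ν.1 u = x) ×ˢ
      (S.image g)ᶜ, (p.1.1.trans (Equiv.swap x p.2).toEmbedding) (root n false) = fun _ => false :=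
    fun p hp => (hfix p hp _ h0).trans p.1.2
  refine Finset.card_le_card_of_injOn
    (fun p => if h : (p.1.1.trans (Equiv.swap x p.2).toEmbedding) (root n false) = fun _ => false
      then ⟨p.1.1.trans (Equiv.swap x p.2).toEmbedding, h⟩ else p.1) ?_ ?_
  · intro p hp
    simp only [dif_pos (hroot p hp)]
    simp only [Finset.coe_filter, Finset.mem_univ, true_and, Set.mem_ofPred_eq]
    intro v hv
    refine (hfix p hp v hv).trans ?_
    exact (Finset.mem_filter.1 (Finset.mem_product.1 hp).1).2.1 v hv
  · intro p hp p' hp' h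
    simp only [dif_pos (hroot p hp), dif_pos (hroot p' hp')] at h
    have hap : ∀ v, Equiv.swap x p.2 (p.1.1 v) = Equiv.swap x p'.2 (p'.1.1 v) := fun v =>
      congrArg (fun ν : Naming n => ν.1 v) h
    have hy : p.2 = p'.2 := by
      have := hap u
      rwa [(Finset.mem_filter.1 (Finset.mem_product.1 hp).1).2.2,
        (Finset.mem_filter.1 (Finset.mem_product.1 hp').1).2.2, Equiv.swap_apply_left,
        Equiv.swap_apply_left] at this
    refine Prod.ext (Subtype.ext (DFunLike.ext _ _ fun v => ?_)) hy
    have := hap v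
    rw [hy] at this
    exact (Equiv.swap x p'.2).injective this

lemma card_naming_agree_mul_le (g : Node n → Names n) {D : ℕ} (S : Finset (Node n))
    (h0 : root n false ∉ S) (hD : D + S.card + 1 ≤ Fintype.card (Names n)) :
    (Finset.univ.filter fun ν : Naming n => ∀ v ∈ insert (root n false) S, ν.1 v = g v).card *
      D ^ S.card ≤ Fintype.card (Naming n) := by
  induction S using Finset.induction_on with
  | empty => simpa using Finset.card_le_univ _
  | insert u S hu ih =>
    rw [Finset.mem_insert, not_or] at h0
    rw [Finset.card_insert_of_notMem hu] at hD ⊢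
    have hu' : u ∉ insert (root n false) S := by
      rw [Finset.mem_insert, not_or]; exact ⟨Ne.symm h0.1, hu⟩
    have h1 := card_naming_eq_mul_le (Finset.mem_insert_self _ S) g hu' (g u)
    rw [Finset.card_insert_of_notMem h0.2] at h1
    have h2 : (Finset.univ.filter fun ν : Naming n =>
        ∀ v ∈ insert (root n false) (insert u S), ν.1 v = g v) =
        Finset.univ.filter fun ν : Naming n =>
          (∀ v ∈ insert (root n false) S, ν.1 v = g v) ∧ ν.1 u = g u := by
      ext ν
      simp only [Finset.mem_filter, Finset.mem_univ, true_and, Finset.forall_mem_insert]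
      exact ⟨fun h => ⟨⟨h.1, h.2.2⟩, h.2.1⟩, fun h => ⟨h.1.1, h.2, h.1.2⟩⟩
    have h3 : D ≤ Fintype.card (Names n) - (S.card + 1) := by omega
    rw [h2, pow_succ', ← mul_assoc]
    exact (Nat.mul_le_mul_right _ ((Nat.mul_le_mul_left _ h3).trans h1)).trans
      (ih h0.2 (by omega))

lemma slotLabel_injective (e : Bool) (j : Fin 3) : Function.Injective fun r => slotLabel e r j := by
  revert e j; decide

section
variable {ω : Shape n} {T : Finset (List Bool)} (f : List Bool → Names n × Fin 3)

lemma card_labels_mul_le (hinj : Set.InjOn (pos ω.1 ω.2) T) :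
    (Finset.univ.filter fun r : Node n → Fin 3 => ∀ w ∈ T,
      slotLabel (ω.2 (pos ω.1 ω.2 w)) (r (pos ω.1 ω.2 w)) (back ω.1 ω.2 w) = (f w).2).card *
        3 ^ T.card ≤ Fintype.card (Node n → Fin 3) := by
  rcases Finset.eq_empty_or_nonempty (Finset.univ.filter fun r : Node n → Fin 3 => ∀ w ∈ T,
    slotLabel (ω.2 (pos ω.1 ω.2 w)) (r (pos ω.1 ω.2 w)) (back ω.1 ω.2 w) = (f w).2) with h | ⟨g, hg⟩
  · simp [h]
  · have key := card_agree_mul (T.image (pos ω.1 ω.2)) g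
    rw [Finset.card_image_of_injOn hinj, Fintype.card_fin] at key
    rw [Fintype.card_fun, Fintype.card_fin, ← key]
    refine Nat.mul_le_mul_right _ (Finset.card_le_card fun r hr => ?_)
    simp only [Finset.mem_filter, Finset.mem_univ, true_and, Finset.forall_mem_image] at hr hg ⊢
    exact fun w hw => slotLabel_injective _ _ ((hr w hw).trans (hg w hw).symm)

lemma card_names_mul_le (hinj : Set.InjOn (pos ω.1 ω.2) T) (hT : [] ∈ T) {D : ℕ}
    (hD : D + T.card ≤ Fintype.card (Names n)) :
    (Finset.univ.filter fun ν : Naming n => ∀ w ∈ T, ν.1 (pos ω.1 ω.2 w) = (f w).1).card *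
      D ^ (T.card - 1) ≤ Fintype.card (Naming n) := by
  rcases Finset.eq_empty_or_nonempty (Finset.univ.filter fun ν : Naming n => ∀ w ∈ T,
    ν.1 (pos ω.1 ω.2 w) = (f w).1) with h | ⟨g, hg⟩
  · simp [h]
  · have h0 : root n false ∈ T.image (pos ω.1 ω.2) := Finset.mem_image.2 ⟨[], hT, rfl⟩
    have hc := Finset.card_image_of_injOn hinj
    have hp := Finset.card_pos.2 ⟨_, hT⟩
    have key := card_naming_agree_mul_le g.1 (D := D)
      ((T.image (pos ω.1 ω.2)).erase (root n false)) (Finset.notMem_erase _ _)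
      (by rw [Finset.card_erase_of_mem h0, hc]; omega)
    rw [Finset.insert_erase h0, Finset.card_erase_of_mem h0, hc] at key
    refine le_trans (Nat.mul_le_mul_right _ (Finset.card_le_card fun ν hν => ?_)) key
    simp only [Finset.mem_filter, Finset.mem_univ, true_and, Finset.forall_mem_image] at hν hg ⊢
    exact fun w hw => (hν w hw).trans (hg w hw).symm

lemma card_names_guess_mul_le (hT : [] ∈ T) (x : Names n) :
    (Finset.univ.filter fun ν : Naming n => (∀ w ∈ T, ν.1 (pos ω.1 ω.2 w) = (f w).1) ∧
        (∀ w ∈ T, (f w).1 ≠ x) ∧ ∃ u, ν.1 u = x).card * (Fintype.card (Names n) - T.card) ≤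
      Fintype.card (Node n) *
        (Finset.univ.filter fun ν : Naming n => ∀ w ∈ T, ν.1 (pos ω.1 ω.2 w) = (f w).1).card := by
  rcases Finset.eq_empty_or_nonempty (Finset.univ.filter fun ν : Naming n => ∀ w ∈ T,
    ν.1 (pos ω.1 ω.2 w) = (f w).1) with h | ⟨g, hg⟩
  · have : (Finset.univ.filter fun ν : Naming n => (∀ w ∈ T, ν.1 (pos ω.1 ω.2 w) = (f w).1) ∧
        (∀ w ∈ T, (f w).1 ≠ x) ∧ ∃ u, ν.1 u = x) = ∅ := by
      rw [Finset.filter_eq_empty_iff] at h ⊢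
      exact fun ν hν h' => h hν h'.1
    rw [this, Finset.card_empty, zero_mul]
    exact Nat.zero_le _
  · have h0 : root n false ∈ T.image (pos ω.1 ω.2) := Finset.mem_image.2 ⟨[], hT, rfl⟩
    simp only [Finset.mem_filter, Finset.mem_univ, true_and] at hg
    have hS : ∀ ν : Naming n, (∀ w ∈ T, ν.1 (pos ω.1 ω.2 w) = (f w).1) ↔
        ∀ v ∈ T.image (pos ω.1 ω.2), ν.1 v = g.1 v := by
      intro ν
      rw [Finset.forall_mem_image]
      exact forall₂_congr fun w hw => by rw [hg w hw]
    have hsub : (Finset.univ.filter fun ν : Naming n => (∀ w ∈ T, ν.1 (pos ω.1 ω.2 w) = (f w).1) ∧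
        (∀ w ∈ T, (f w).1 ≠ x) ∧ ∃ u, ν.1 u = x) ⊆
        (Finset.univ.filter fun u => u ∉ T.image (pos ω.1 ω.2)).biUnion fun u =>
          Finset.univ.filter fun ν : Naming n =>
            (∀ v ∈ T.image (pos ω.1 ω.2), ν.1 v = g.1 v) ∧ ν.1 u = x := by
      intro ν hν
      simp only [Finset.mem_filter, Finset.mem_univ, true_and] at hν
      obtain ⟨h1, h2, u, hu⟩ := hν
      simp only [Finset.mem_biUnion, Finset.mem_filter, Finset.mem_univ, true_and]
      refine ⟨u, fun hu' => ?_, (hS ν).1 h1, hu⟩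
      obtain ⟨w, hw, rfl⟩ := Finset.mem_image.1 hu'
      exact h2 w hw ((h1 w hw).symm.trans hu)
    refine (Nat.mul_le_mul_right _
      ((Finset.card_le_card hsub).trans Finset.card_biUnion_le)).trans ?_
    rw [Finset.sum_mul]
    refine (Finset.sum_le_card_nsmul _ _ (Finset.univ.filter fun ν : Naming n => ∀ w ∈ T,
      ν.1 (pos ω.1 ω.2 w) = (f w).1).card fun u hu => ?_).trans ?_
    · have hc : (T.image (pos ω.1 ω.2)).card ≤ T.card := Finset.card_image_le
      refine (Nat.mul_le_mul_left _ (by omega)).trans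
        ((card_naming_eq_mul_le h0 g.1 (Finset.mem_filter.1 hu).2 x).trans (le_of_eq ?_))
      simp only [hS]
    · rw [smul_eq_mul]
      exact Nat.mul_le_mul_right _ (Finset.card_le_univ _)

/-- Instances of shapes in `X` with a prescribed tape on `T`. -/
lemma card_tape_agree_mul_le {X : Finset (Shape n)}
    (hinj : ∀ ω ∈ X, Set.InjOn (pos ω.1 ω.2) T) (hT : [] ∈ T) {D : ℕ}
    (hD : D + T.card ≤ Fintype.card (Names n)) :
    (Finset.univ.filter fun M : Model n => (∀ w ∈ T, tape M w = f w) ∧ M.1 ∈ X).card *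
        (3 ^ T.card * D ^ (T.card - 1)) ≤
      X.card * (Fintype.card (Node n → Fin 3) * Fintype.card (Naming n)) := by
  have hsub : (Finset.univ.filter fun M : Model n => (∀ w ∈ T, tape M w = f w) ∧ M.1 ∈ X) ⊆
      X.biUnion fun ω => ({ω} : Finset (Shape n)) ×ˢ ((Finset.univ.filter fun r : Node n → Fin 3 =>
        ∀ w ∈ T, slotLabel (ω.2 (pos ω.1 ω.2 w)) (r (pos ω.1 ω.2 w)) (back ω.1 ω.2 w) = (f w).2) ×ˢ
        (Finset.univ.filter fun ν : Naming n => ∀ w ∈ T, ν.1 (pos ω.1 ω.2 w) = (f w).1)) := by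
    rintro ⟨ω, r, ν⟩ hM
    simp only [Finset.mem_filter, Finset.mem_univ, true_and] at hM
    simp only [Finset.mem_biUnion, Finset.mem_product, Finset.mem_singleton, Finset.mem_filter,
      Finset.mem_univ, true_and]
    exact ⟨ω, hM.2, rfl, fun w hw => congrArg Prod.snd (hM.1 w hw),
      fun w hw => congrArg Prod.fst (hM.1 w hw)⟩
  refine (Nat.mul_le_mul_right _ ((Finset.card_le_card hsub).trans Finset.card_biUnion_le)).trans ?_
  rw [Finset.sum_mul]
  refine (Finset.sum_le_card_nsmul _ _ _ fun ω hω => ?_).trans_eq (smul_eq_mul _ _)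
  rw [Finset.card_product, Finset.card_product, Finset.card_singleton, one_mul, mul_mul_mul_comm]
  exact Nat.mul_le_mul (card_labels_mul_le f (hinj ω hω)) (card_names_mul_le f (hinj ω hω) hT hD)

/-- Instances with a prescribed tape on `T` in which an unused name is hit. -/
lemma card_tape_guess_mul_le {X : Finset (Shape n)}
    (hinj : ∀ ω ∈ X, Set.InjOn (pos ω.1 ω.2) T) (hT : [] ∈ T) {D : ℕ}
    (hD : D + T.card ≤ Fintype.card (Names n)) (x : Names n) :
    (Finset.univ.filter fun M : Model n => (∀ w ∈ T, tape M w = f w) ∧ M.1 ∈ X ∧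
        (∀ w ∈ T, (f w).1 ≠ x) ∧ ∃ u, M.2.2.1 u = x).card *
        (3 ^ T.card * (D * D ^ (T.card - 1))) ≤
      X.card * (Fintype.card (Node n → Fin 3) * (Fintype.card (Node n) *
        Fintype.card (Naming n))) := by
  have hsub : (Finset.univ.filter fun M : Model n => (∀ w ∈ T, tape M w = f w) ∧ M.1 ∈ X ∧
        (∀ w ∈ T, (f w).1 ≠ x) ∧ ∃ u, M.2.2.1 u = x) ⊆
      X.biUnion fun ω => ({ω} : Finset (Shape n)) ×ˢ ((Finset.univ.filter fun r : Node n → Fin 3 =>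
        ∀ w ∈ T, slotLabel (ω.2 (pos ω.1 ω.2 w)) (r (pos ω.1 ω.2 w)) (back ω.1 ω.2 w) = (f w).2) ×ˢ
        (Finset.univ.filter fun ν : Naming n => (∀ w ∈ T, ν.1 (pos ω.1 ω.2 w) = (f w).1) ∧
          (∀ w ∈ T, (f w).1 ≠ x) ∧ ∃ u, ν.1 u = x)) := by
    rintro ⟨ω, r, ν⟩ hM
    simp only [Finset.mem_filter, Finset.mem_univ, true_and] at hM
    simp only [Finset.mem_biUnion, Finset.mem_product, Finset.mem_singleton, Finset.mem_filter,
      Finset.mem_univ, true_and]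
    exact ⟨ω, hM.2.1, rfl, fun w hw => congrArg Prod.snd (hM.1 w hw),
      fun w hw => congrArg Prod.fst (hM.1 w hw), hM.2.2⟩
  refine (Nat.mul_le_mul_right _ ((Finset.card_le_card hsub).trans Finset.card_biUnion_le)).trans ?_
  rw [Finset.sum_mul]
  refine (Finset.sum_le_card_nsmul _ _ _ fun ω hω => ?_).trans_eq (smul_eq_mul _ _)
  rw [Finset.card_product, Finset.card_product, Finset.card_singleton, one_mul, mul_mul_mul_comm]
  refine Nat.mul_le_mul (card_labels_mul_le f (hinj ω hω)) ?_
  rw [← mul_assoc]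
  refine (Nat.mul_le_mul_right _ ((Nat.mul_le_mul_left _ (by omega)).trans
    (card_names_guess_mul_le f hT x))).trans ?_
  rw [mul_assoc]
  exact Nat.mul_le_mul_left _ (card_names_mul_le f (hinj ω hω) hT hD)

end

/-! ### Adaptive exploration -/

/-- An adaptively explored random tape may be replaced by a uniform one. -/
lemma card_stopped_mul_le {Ω ι B : Type*} [Fintype Ω] [Fintype ι] [Fintype B]
    (g : Ω → ι → B) (τ : (ι → B) → Finset ι) (Q : (ι → B) → Ω → Prop) (F : Finset (ι → B)) {C : ℝ}
    (hτ : ∀ f f', (∀ i ∈ τ f, f i = f' i) → τ f' = τ f)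
    (hQ : ∀ f f' x, (∀ i ∈ τ f, f i = f' i) → Q f x → Q f' x)
    (hF : ∀ x f, (∀ i ∈ τ (g x), g x i = f i) → f ∈ F)
    (hC : ∀ f ∈ F, ((Finset.univ.filter fun x => (∀ i ∈ τ f, g x i = f i) ∧ Q f x).card : ℝ) *
      (Fintype.card B : ℝ) ^ (τ f).card ≤ C) :
    ((Finset.univ.filter fun x => Q (g x) x).card : ℝ) *
      (Fintype.card B : ℝ) ^ Fintype.card ι ≤ F.card * C := by
  have key : ∀ x ∈ Finset.univ.filter fun x => Q (g x) x,
      (Fintype.card B : ℝ) ^ Fintype.card ι ≤ ∑ f ∈ F,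
        if (∀ i ∈ τ f, g x i = f i) ∧ Q f x then (Fintype.card B : ℝ) ^ (τ f).card else 0 := by
    intro x hx
    have hx := (Finset.mem_filter.1 hx).2
    have h1 := card_agree_mul (τ (g x)) (g x)
    have h2 : (Finset.univ.filter fun f : ι → B => ∀ i ∈ τ (g x), f i = g x i) ⊆ F := by
      intro f hf
      exact hF x f fun i hi => ((Finset.mem_filter.1 hf).2 i hi).symm
    refine le_trans (le_of_eq ?_) (Finset.sum_le_sum_of_subset_of_nonneg h2 fun f _ _ => ?_)
    · have h3 : ∀ f ∈ Finset.univ.filter fun f : ι → B => ∀ i ∈ τ (g x), f i = g x i,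
          (if (∀ i ∈ τ f, g x i = f i) ∧ Q f x then (Fintype.card B : ℝ) ^ (τ f).card else 0) =
            (Fintype.card B : ℝ) ^ (τ (g x)).card := by
        intro f hf
        have hf : ∀ i ∈ τ (g x), g x i = f i := fun i hi => ((Finset.mem_filter.1 hf).2 i hi).symm
        have ht := hτ _ _ hf
        rw [ht, if_pos ⟨hf, hQ _ _ _ hf hx⟩]
      rw [Finset.sum_congr rfl h3, Finset.sum_const, nsmul_eq_mul]
      exact_mod_cast h1.symm
    · split_ifs <;> positivity
  calc ((Finset.univ.filter fun x => Q (g x) x).card : ℝ) *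
        (Fintype.card B : ℝ) ^ Fintype.card ι
      = ∑ x ∈ Finset.univ.filter fun x => Q (g x) x, (Fintype.card B : ℝ) ^ Fintype.card ι := by
        rw [Finset.sum_const, nsmul_eq_mul]
    _ ≤ ∑ x ∈ Finset.univ.filter fun x => Q (g x) x, ∑ f ∈ F,
          if (∀ i ∈ τ f, g x i = f i) ∧ Q f x then (Fintype.card B : ℝ) ^ (τ f).card else 0 :=
        Finset.sum_le_sum key
    _ ≤ ∑ x, ∑ f ∈ F,
          if (∀ i ∈ τ f, g x i = f i) ∧ Q f x then (Fintype.card B : ℝ) ^ (τ f).card else 0 := by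
        refine Finset.sum_le_sum_of_subset_of_nonneg (Finset.filter_subset _ _) fun x _ _ =>
          Finset.sum_nonneg fun f _ => ?_
        split_ifs <;> positivity
    _ = ∑ f ∈ F, ((Finset.univ.filter fun x => (∀ i ∈ τ f, g x i = f i) ∧ Q f x).card : ℝ) *
          (Fintype.card B : ℝ) ^ (τ f).card := by
        rw [Finset.sum_comm]
        refine Finset.sum_congr rfl fun f _ => ?_
        rw [← Finset.sum_filter, Finset.sum_const, nsmul_eq_mul]
    _ ≤ F.card * C := by
        rw [← nsmul_eq_mul]
        exact Finset.sum_le_card_nsmul _ _ _ hC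

/-- Words of length at most `k`. -/
abbrev Word (k : ℕ) := {w : List Bool // w.length ≤ k}

noncomputable instance (k : ℕ) : Fintype (Word k) :=
  @Fintype.ofFinite _ (List.finite_length_le Bool k)

/-- A tape on short words, extended by an arbitrary value. -/
noncomputable def padTape {k : ℕ} (f : Word k → Names n × Fin 3) (w : List Bool) :
    Names n × Fin 3 :=
  if h : w.length ≤ k then f ⟨w, h⟩ else (fun _ => false, 0)

lemma padTape_apply {k : ℕ} (f : Word k → Names n × Fin 3) (w : Word k) :
    padTape f w.1 = f w := by
  simp [padTape, w.2]

lemma card_filter_fst_mul_le {ι B C : Type*} [Fintype ι] [Fintype B] [Fintype C] [Nonempty C]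
    (i : ι) (b : B) :
    (Finset.univ.filter fun f : ι → B × C => (f i).1 = b).card * Fintype.card B ≤
      Fintype.card (B × C) ^ Fintype.card ι := by
  have hsub : (Finset.univ.filter fun f : ι → B × C => (f i).1 = b) ⊆
      (Finset.univ : Finset C).biUnion fun c =>
        Finset.univ.filter fun f : ι → B × C => ∀ j ∈ ({i} : Finset ι), f j = (b, c) := by
    intro f hf
    simp only [Finset.mem_filter, Finset.mem_univ, true_and, Finset.mem_biUnion,
      Finset.mem_singleton, forall_eq] at hf ⊢
    exact ⟨_, Prod.ext hf rfl⟩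
  have hc : ∀ c : C, (Finset.univ.filter fun f : ι → B × C =>
      ∀ j ∈ ({i} : Finset ι), f j = (b, c)).card * Fintype.card (B × C) =
      Fintype.card (B × C) ^ Fintype.card ι := fun c => by
    have := card_agree_mul ({i} : Finset ι) (fun _ => (b, c))
    rw [Finset.card_singleton, pow_one] at this
    convert this
  have h1 := Nat.mul_le_mul_right (Fintype.card (B × C))
    ((Finset.card_le_card hsub).trans Finset.card_biUnion_le)
  rw [Finset.sum_mul, Finset.sum_congr rfl fun c _ => hc c, Finset.sum_const, Finset.card_univ,
    smul_eq_mul] at h1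
  refine Nat.le_of_mul_le_mul_left ?_ (Fintype.card_pos (α := C))
  refine le_trans (le_of_eq ?_) h1
  rw [Fintype.card_prod]
  ring

/-- The probability of an event that only depends on the explored part of the tape is bounded by
its conditional probabilities. -/
lemma card_event_le (A : Strategy n) (k : ℕ)
    (Q : (List Bool → Names n × Fin 3) → Model n → Prop) {C : ℝ} (hC0 : 0 ≤ C)
    (hQ : ∀ f f' M, (∀ w ∈ (run f A k).2, f w = f' w) → Q f M → Q f' M)
    (hC : ∀ f : List Bool → Names n × Fin 3,
      ((Finset.univ.filter fun M : Model n =>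
        (∀ w ∈ (run f A k).2, tape M w = f w) ∧ Q f M).card : ℝ) *
      (Fintype.card (Names n × Fin 3) : ℝ) ^ (run f A k).2.card ≤ Fintype.card (Names n) * C) :
    ((Finset.univ.filter fun M : Model n => Q (tape M) M).card : ℝ) ≤ C := by
  let g : Model n → Word k → Names n × Fin 3 := fun M w => tape M w.1
  let τ : (Word k → Names n × Fin 3) → Finset (Word k) := fun f =>
    (run (padTape f) A k).2.subtype fun w => w.length ≤ k
  have hmem : ∀ f (w : Word k), w ∈ τ f ↔ w.1 ∈ (run (padTape f) A k).2 := fun f w =>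
    Finset.mem_subtype
  have hall : ∀ f {P : List Bool → Prop}, (∀ w ∈ τ f, P w.1) ↔
      ∀ w ∈ (run (padTape f) A k).2, P w := fun f P =>
    ⟨fun h w hw => h ⟨w, run_length_le _ _ _ w hw⟩ ((hmem _ _).2 hw),
      fun h w hw => h _ ((hmem _ _).1 hw)⟩
  have hagree : ∀ f f' : Word k → Names n × Fin 3, (∀ w ∈ τ f, f w = f' w) →
      ∀ w ∈ (run (padTape f) A k).2, padTape f w = padTape f' w := fun f f' h => by
    rw [← hall f]
    intro w hw
    rw [padTape_apply, padTape_apply, h w hw]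
  have hcard : ∀ f, (τ f).card = (run (padTape f) A k).2.card := fun f => by
    rw [Finset.card_subtype, Finset.filter_true_of_mem fun w hw => run_length_le _ _ _ w hw]
  have htape : ∀ M : Model n, ∀ w ∈ (run (padTape (g M)) A k).2, padTape (g M) w = tape M w :=
    fun M => by
      rw [← hall]
      intro w _
      rw [padTape_apply]
  have key := card_stopped_mul_le g τ (fun f => Q (padTape f))
    (Finset.univ.filter fun f : Word k → Names n × Fin 3 =>
      (f ⟨[], Nat.zero_le k⟩).1 = fun _ => false) (C := Fintype.card (Names n) * C)
    (fun f f' h => by simp only [τ, run_congr A k (hagree f f' h)])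
    (fun f f' M h => hQ _ _ _ (hagree f f' h))
    (fun M f h => by
      have h0 := h ⟨[], Nat.zero_le k⟩ ((hmem _ _).2 (run_suffixClosed _ _ _).nil_mem)
      simp only [Finset.mem_filter, Finset.mem_univ, true_and]
      rw [← h0]
      exact M.2.2.2)
    (fun f _ => by
      rw [hcard]
      convert hC (padTape f) using 5
      refine and_congr_left fun _ => ?_
      rw [← hall f]
      exact forall₂_congr fun w _ => by rw [padTape_apply])
  have hle : ((Finset.univ.filter fun M : Model n => Q (tape M) M).card : ℝ) ≤
      ((Finset.univ.filter fun M : Model n => Q (padTape (g M)) M).card : ℝ) := by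
    refine Nat.cast_le.2 (Finset.card_le_card fun M hM => ?_)
    simp only [Finset.mem_filter, Finset.mem_univ, true_and] at hM ⊢
    have := run_congr A k (htape M)
    refine hQ _ _ _ (fun w hw => ?_) hM
    rw [this] at hw
    exact (htape M w hw).symm
  have hb : (0 : ℝ) < (Fintype.card (Names n × Fin 3) : ℝ) ^ Fintype.card (Word k) := by
    have : 0 < Fintype.card (Names n × Fin 3) := Fintype.card_pos
    positivity
  have hF : ((Finset.univ.filter fun f : Word k → Names n × Fin 3 =>
      (f ⟨[], Nat.zero_le k⟩).1 = fun _ => false).card : ℝ) * Fintype.card (Names n) ≤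
      (Fintype.card (Names n × Fin 3) : ℝ) ^ Fintype.card (Word k) := by
    rw [← Nat.cast_mul, ← Nat.cast_pow, Nat.cast_le]
    convert card_filter_fst_mul_le (C := Fin 3) (⟨[], Nat.zero_le k⟩ : Word k)
      (fun _ => false : Names n)
  refine hle.trans (le_of_mul_le_mul_right ?_ hb)
  calc _ ≤ _ := key
    _ ≤ C * (Fintype.card (Names n × Fin 3) : ℝ) ^ Fintype.card (Word k) := by
      rw [← mul_assoc, mul_comm C]
      exact mul_le_mul_of_nonneg_right hF hC0

section
variable {m K q D : ℕ} {κ : ℝ}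

/-- Passing from the exact to the uniform weight of a prescribed tape. -/
lemma weight_le {c t : ℕ} (ht : 0 < t) {Z : ℝ}
    (hκ : (Fintype.card (Names n) : ℝ) ^ (t - 1) ≤ κ * (D : ℝ) ^ (t - 1))
    (h : (c : ℝ) * (3 ^ t * (D : ℝ) ^ (t - 1)) ≤ Z) (hκ0 : 0 ≤ κ) :
    (c : ℝ) * (Fintype.card (Names n × Fin 3) : ℝ) ^ t ≤ Fintype.card (Names n) * (κ * Z) := by
  rw [Fintype.card_prod, Fintype.card_fin, Nat.cast_mul, Nat.cast_ofNat, mul_pow]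
  obtain ⟨s, rfl⟩ : ∃ s, t = s + 1 := ⟨t - 1, by omega⟩
  rw [Nat.add_sub_cancel] at hκ h
  set N : ℝ := (Fintype.card (Names n) : ℝ) with hN
  have hN0 : 0 ≤ N := Nat.cast_nonneg _
  calc (c : ℝ) * (N ^ (s + 1) * 3 ^ (s + 1)) = N * ((c * 3 ^ (s + 1)) * N ^ s) := by ring
    _ ≤ N * ((c * 3 ^ (s + 1)) * (κ * (D : ℝ) ^ s)) := by gcongr
    _ = N * (κ * (c * (3 ^ (s + 1) * (D : ℝ) ^ s))) := by ring
    _ ≤ N * (κ * Z) := by gcongr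

lemma card_model_eq : (Fintype.card (Model n) : ℝ) = Fintype.card (Shape n) *
    (Fintype.card (Node n → Fin 3) * Fintype.card (Naming n)) := by
  rw [← Nat.cast_mul, ← Nat.cast_mul, ← Fintype.card_prod, ← Fintype.card_prod]

/-- The exploration tree ceases to be good in step `k`. -/
def SpoilEvent (m K : ℕ) (A : Strategy n) (k : ℕ) (f : List Bool → Names n × Fin 3)
    (ω : Shape n) : Prop :=
  Good m K ω.1 ω.2 (run f A k).2 ∧ ¬ Good m K ω.1 ω.2 (run f A (k + 1)).2

/-- A lucky guess is made in step `k` while the exploration tree is good. -/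
def GuessEvent (m K : ℕ) (A : Strategy n) (k : ℕ) (f : List Bool → Names n × Fin 3)
    (M : Model n) : Prop :=
  Good m K M.1.1 M.1.2 (run f A k).2 ∧ LuckyGuess M f A k

/-- The probability of spoiling the exploration tree in one step. -/
lemma card_spoilEvent_le (hm : 0 < m) (hmn : m < n) (hK : K < 2 * 2 ^ n) (A : Strategy n) {k : ℕ}
    (hkK : 2 * k ≤ K) (hD : D + (2 * k + 1) ≤ Fintype.card (Names n)) (hκ0 : 0 ≤ κ)
    (hκ : ∀ t ≤ 2 * k, (Fintype.card (Names n) : ℝ) ^ t ≤ κ * (D : ℝ) ^ t) {δ : ℝ} (hδ0 : 0 ≤ δ)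
    (hδ : ∀ f : List Bool → Names n × Fin 3,
      ((Finset.univ.filter (SpoilEvent m K A k f)).card : ℝ) ≤ δ * Fintype.card (Shape n)) :
    ((Finset.univ.filter fun M : Model n => SpoilEvent m K A k (tape M) M.1).card : ℝ) ≤
        κ * δ * Fintype.card (Model n) := by
  refine card_event_le A k (fun f M => SpoilEvent m K A k f M.1) (by positivity) ?_ ?_
  · intro f f' M h hQ
    rwa [SpoilEvent, run_congr A k h, run_succ_congr A k h]
  · intro f
    have hT := run_suffixClosed f A k
    have hc := card_run_le f A k
    have hp := Finset.card_pos.2 ⟨_, hT.nil_mem⟩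
    have h1 := card_tape_agree_mul_le f (T := (run f A k).2) (D := D)
      (X := Finset.univ.filter (SpoilEvent m K A k f))
      (fun ω hω w₁ h₁ w₂ h₂ h => (Finset.mem_filter.1 hω).2.1.pos_injOn hm hmn hK
        (fun w hw => by have := run_length_le f A k w hw; omega) hT h₁ h₂ h) hT.nil_mem (by omega)
    have hX : (Finset.univ.filter fun M : Model n =>
        (∀ w ∈ (run f A k).2, tape M w = f w) ∧ SpoilEvent m K A k f M.1).card ≤
        (Finset.univ.filter fun M : Model n => (∀ w ∈ (run f A k).2, tape M w = f w) ∧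
          M.1 ∈ Finset.univ.filter (SpoilEvent m K A k f)).card :=
      Finset.card_le_card fun M hM => by
        simpa only [Finset.mem_filter, Finset.mem_univ, true_and] using hM
    have h2 : ((Finset.univ.filter fun M : Model n =>
        (∀ w ∈ (run f A k).2, tape M w = f w) ∧ SpoilEvent m K A k f M.1).card : ℝ) *
        (3 ^ (run f A k).2.card * (D : ℝ) ^ ((run f A k).2.card - 1)) ≤
        ((Finset.univ.filter (SpoilEvent m K A k f)).card : ℝ) *
          (Fintype.card (Node n → Fin 3) * Fintype.card (Naming n)) := by
      exact_mod_cast (Nat.mul_le_mul_right _ hX).trans h1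
    refine (weight_le hp (hκ _ (by omega)) h2 hκ0).trans ?_
    rw [card_model_eq]
    calc _ ≤ (Fintype.card (Names n) : ℝ) * (κ * (δ * Fintype.card (Shape n) *
          (Fintype.card (Node n → Fin 3) * Fintype.card (Naming n)))) :=
          mul_le_mul_of_nonneg_left (mul_le_mul_of_nonneg_left (mul_le_mul_of_nonneg_right (hδ f)
            (mul_nonneg (Nat.cast_nonneg _) (Nat.cast_nonneg _))) hκ0) (Nat.cast_nonneg _)
      _ = _ := by ring

/-- The probability of a lucky guess. -/
lemma card_guessEvent_le (hm : 0 < m) (hmn : m < n) (hK : K < 2 * 2 ^ n) (A : Strategy n) {k : ℕ}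
    (hkK : 2 * k ≤ K) (hD : D + (2 * k + 1) ≤ Fintype.card (Names n)) (hD0 : 0 < D) (hκ0 : 0 ≤ κ)
    (hκ : ∀ t ≤ 2 * k, (Fintype.card (Names n) : ℝ) ^ t ≤ κ * (D : ℝ) ^ t) :
    ((Finset.univ.filter fun M : Model n => GuessEvent m K A k (tape M) M).card : ℝ) ≤
        κ * (Fintype.card (Node n) / D) * Fintype.card (Model n) := by
  refine card_event_le A k (GuessEvent m K A k) (by positivity) ?_ ?_
  · intro f f' M h hQ
    rw [GuessEvent, LuckyGuess, run_congr A k h]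
    exact ⟨hQ.1, fun w hw => by rw [← h w hw]; exact hQ.2.1 w hw, hQ.2.2⟩
  · intro f
    have hT := run_suffixClosed f A k
    have hc := card_run_le f A k
    have hp := Finset.card_pos.2 ⟨_, hT.nil_mem⟩
    set X := Finset.univ.filter fun ω : Shape n => Good m K ω.1 ω.2 (run f A k).2 with hX
    have h1 := card_tape_guess_mul_le f (T := (run f A k).2) (D := D) (X := X)
      (fun ω hω w₁ h₁ w₂ h₂ h => (Finset.mem_filter.1 hω).2.pos_injOn hm hmn hK
        (fun w hw => by have := run_length_le f A k w hw; omega) hT h₁ h₂ h) hT.nil_mem (by omega)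
      (A (run f A k).1)
    have h2 : (Finset.univ.filter fun M : Model n =>
        (∀ w ∈ (run f A k).2, tape M w = f w) ∧ GuessEvent m K A k f M).card ≤
        (Finset.univ.filter fun M : Model n => (∀ w ∈ (run f A k).2, tape M w = f w) ∧ M.1 ∈ X ∧
          (∀ w ∈ (run f A k).2, (f w).1 ≠ A (run f A k).1) ∧
            ∃ u, M.2.2.1 u = A (run f A k).1).card :=
      Finset.card_le_card fun M hM => by
        have hM := (Finset.mem_filter.1 hM).2
        exact Finset.mem_filter.2 ⟨Finset.mem_univ _, hM.1,
          Finset.mem_filter.2 ⟨Finset.mem_univ _, hM.2.1⟩, hM.2.2⟩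
    have h3 := (Nat.mul_le_mul_right _ h2).trans (h1.trans (Nat.mul_le_mul_right _
      (Finset.card_le_univ X)))
    set c := (Finset.univ.filter fun M : Model n =>
        (∀ w ∈ (run f A k).2, tape M w = f w) ∧ GuessEvent m K A k f M).card
    have hD' : (0 : ℝ) < D := Nat.cast_pos.2 hD0
    have h4 : (c : ℝ) * (3 ^ (run f A k).2.card * (D : ℝ) ^ ((run f A k).2.card - 1)) ≤
        Fintype.card (Shape n) * (Fintype.card (Node n → Fin 3) * (Fintype.card (Node n) *
          Fintype.card (Naming n))) / D := by
      rw [le_div_iff₀ hD']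
      calc _ = (c : ℝ) *
            (3 ^ (run f A k).2.card * (D * (D : ℝ) ^ ((run f A k).2.card - 1))) := by ring
        _ ≤ _ := by exact_mod_cast h3
    refine (weight_le hp (hκ _ (by omega)) h4 hκ0).trans (le_of_eq ?_)
    rw [card_model_eq]
    ring

end

/-! ### The lower bound -/

lemma card_spoiled_le_of_mem {m h K : ℕ} (hm : 0 < m) (hh : 0 < h) (hmh : m + h = n)
    (hK : K < 2 * 2 ^ n) {T : Finset (List Bool)} (hT : SuffixClosed T)
    (hTK : ∀ w ∈ T, 2 * w.length ≤ K) {a : List Bool} {d : Bool} (ha : a ∈ T)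
    {M : ℕ} (hM : 0 < M) (hMK : M + K + 3 ≤ 2 ^ n) {c : ℕ} (hc : T.card ≤ c) :
    ((spoiled n m K T (d :: a)).card : ℝ) ≤
      (1 / 2 ^ h + c * (2 * 2 ^ h + (2 * K + 1)) / M) * Fintype.card (Shape n) := by
  have hc' : (T.card : ℝ) ≤ c := Nat.cast_le.2 hc
  have h0 : (0 : ℝ) ≤ 1 / 2 ^ h + c * (2 * 2 ^ h + (2 * K + 1)) / M := by positivity
  by_cases hw : d :: a ∈ T
  · have he : spoiled n m K T (d :: a) = ∅ := by
      rw [spoiled, Finset.insert_eq_of_mem hw]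
      exact Finset.filter_eq_empty_iff.2 fun ω _ h => h.2 h.1
    rw [he, Finset.card_empty, Nat.cast_zero]
    exact mul_nonneg h0 (Nat.cast_nonneg _)
  · refine (card_spoiled_le hm hh hmh hK hT hTK ha hw hM hMK).trans ?_
    rw [mul_comm]
    refine mul_le_mul_of_nonneg_right ?_ (Nat.cast_nonneg _)
    gcongr

lemma card_spoilEvent_shape_le {m h q : ℕ} (hm : 0 < m) (hh : 0 < h) (hmh : m + h = n)
    {M : ℕ} (hM : 0 < M) (hMK : M + 2 * q + 3 ≤ 2 ^ n) (A : Strategy n) {k : ℕ} (hk : k < q)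
    (f : List Bool → Names n × Fin 3) :
    ((Finset.univ.filter (SpoilEvent m (2 * q) A k f)).card : ℝ) ≤
      2 * (1 / 2 ^ h + 2 * q * (2 * 2 ^ h + (4 * q + 1)) / M) * Fintype.card (Shape n) := by
  have hK : 2 * q < 2 * 2 ^ n := by omega
  have hT := run_suffixClosed f A k
  have hl := run_length_le f A k
  have hc := card_run_le f A k
  set T := (run f A k).2 with hTdef
  rcases ho : lookup f T (A (run f A k).1) with _ | w
  · have he : Finset.univ.filter (SpoilEvent m (2 * q) A k f) = ∅ := by
      refine Finset.filter_eq_empty_iff.2 fun ω _ hω => hω.2 ?_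
      have h1 : (run f A (k + 1)).2 = T := by
        simp only [run]; rw [← hTdef, ho]; rfl
      rw [h1]; exact hω.1
    rw [he, Finset.card_empty, Nat.cast_zero]
    exact mul_nonneg (by positivity) (Nat.cast_nonneg _)
  · have hw := (lookup_eq_some ho).1
    have h1 : (run f A (k + 1)).2 = insert (true :: w) (insert (false :: w) T) := by
      simp only [run]; rw [← hTdef, ho]; rfl
    have hsub : Finset.univ.filter (SpoilEvent m (2 * q) A k f) ⊆
        spoiled n m (2 * q) T (false :: w) ∪
          spoiled n m (2 * q) (insert (false :: w) T) (true :: w) := by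
      intro ω hω
      obtain ⟨hG, hB⟩ := (Finset.mem_filter.1 hω).2
      rw [h1] at hB
      by_cases hI : Good m (2 * q) ω.1 ω.2 (insert (false :: w) T)
      · exact Finset.mem_union_right _ (Finset.mem_filter.2 ⟨Finset.mem_univ _, hI, hB⟩)
      · exact Finset.mem_union_left _ (Finset.mem_filter.2 ⟨Finset.mem_univ _, hG, hI⟩)
    have hci := Finset.card_insert_le (false :: w) T
    have hA := card_spoiled_le_of_mem (d := false) (c := 2 * q) hm hh hmh hK hT
      (fun v hv => by have := hl v hv; omega) hw hM hMK (by omega)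
    have hB := card_spoiled_le_of_mem (d := true) (c := 2 * q) hm hh hmh hK
      (hT.insert (d := false) hw)
      (fun v hv => by
        have hlw := hl w hw
        rcases Finset.mem_insert.1 hv with rfl | hv
        · simp only [List.length_cons]; omega
        · have := hl v hv; omega) (Finset.mem_insert_of_mem hw) hM hMK (by omega)
    have hU : ((Finset.univ.filter (SpoilEvent m (2 * q) A k f)).card : ℝ) ≤
        (spoiled n m (2 * q) T (false :: w)).card +
          (spoiled n m (2 * q) (insert (false :: w) T) (true :: w)).card := by
      exact_mod_cast (Finset.card_le_card hsub).trans (Finset.card_union_le _ _)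
    push_cast at hA hB
    refine (hU.trans (add_le_add hA hB)).trans (le_of_eq ?_)
    ring

lemma card_modelWins_le {m K q D : ℕ} {κ δ : ℝ} (hm : 0 < m) (hmn : m < n) (hK : K < 2 * 2 ^ n)
    (hqK : 2 * q ≤ K) (A : Strategy n) (hD : D + (2 * q + 1) ≤ Fintype.card (Names n))
    (hD0 : 0 < D) (hκ0 : 0 ≤ κ)
    (hκ : ∀ t ≤ 2 * q, (Fintype.card (Names n) : ℝ) ^ t ≤ κ * (D : ℝ) ^ t) (hδ0 : 0 ≤ δ)
    (hδ : ∀ k < q, ∀ f : List Bool → Names n × Fin 3,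
      ((Finset.univ.filter (SpoilEvent m K A k f)).card : ℝ) ≤ δ * Fintype.card (Shape n)) :
    ((Finset.univ.filter fun M : Model n => ModelWins M A q).card : ℝ) ≤
      q * (κ * (Fintype.card (Node n) / D + δ)) * Fintype.card (Model n) := by
  set E : ℕ → Finset (Model n) := fun k =>
    (Finset.univ.filter fun M : Model n => GuessEvent m K A k (tape M) M) ∪
      Finset.univ.filter fun M : Model n => SpoilEvent m K A k (tape M) M.1
  have hsub : (Finset.univ.filter fun M : Model n => ModelWins M A q) ⊆
      (Finset.range q).biUnion E := by
    intro M hM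
    obtain ⟨k, hk, hG, h⟩ := (Finset.mem_filter.1 hM).2.exists_event (K := K) hm hmn
    refine Finset.mem_biUnion.2 ⟨k, Finset.mem_range.2 hk, ?_⟩
    rcases h with h | h
    · exact Finset.mem_union_left _ (Finset.mem_filter.2 ⟨Finset.mem_univ _, hG, h⟩)
    · exact Finset.mem_union_right _ (Finset.mem_filter.2 ⟨Finset.mem_univ _, hG, h⟩)
  have hE : ∀ k ∈ Finset.range q, ((E k).card : ℝ) ≤
      κ * (Fintype.card (Node n) / D + δ) * Fintype.card (Model n) := by
    intro k hk
    have hk := Finset.mem_range.1 hk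
    have h1 := card_guessEvent_le hm hmn hK A (k := k) (by omega) (D := D) (by omega) hD0 hκ0
      fun t ht => hκ t (by omega)
    have h2 := card_spoilEvent_le hm hmn hK A (k := k) (by omega) (D := D) (by omega) hκ0
      (fun t ht => hκ t (by omega)) hδ0 (hδ k hk)
    have h3 := Nat.cast_le (α := ℝ).2 (Finset.card_union_le
      (Finset.univ.filter fun M : Model n => GuessEvent m K A k (tape M) M)
      (Finset.univ.filter fun M : Model n => SpoilEvent m K A k (tape M) M.1))
    rw [Nat.cast_add] at h3
    refine (h3.trans (add_le_add h1 h2)).trans (le_of_eq ?_)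
    ring
  have h1 : ((Finset.univ.filter fun M : Model n => ModelWins M A q).card : ℝ) ≤
      ∑ k ∈ Finset.range q, ((E k).card : ℝ) := by
    exact_mod_cast (Finset.card_le_card hsub).trans Finset.card_biUnion_le
  refine (h1.trans (Finset.sum_le_sum hE)).trans (le_of_eq ?_)
  rw [Finset.sum_const, Finset.card_range, nsmul_eq_mul]
  ring

lemma card_node_le : Fintype.card (Node n) ≤ 4 * 2 ^ n := by
  have hσ : Fintype.card (Fin (2 ^ n)) = Fintype.card (Fin n → Bool) := by simp
  let σ := Fintype.equivOfCardEq hσ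
  rw [← Fintype.card_congr (nodeEquiv (attachOf σ σ)), Fintype.card_prod, Fintype.card_sigma]
  have h : ∑ j : Fin (n + 1), Fintype.card (Fin j.val → Bool) = 2 ^ (n + 1) - 1 := by
    simp only [Fintype.card_pi, Fintype.card_bool, Finset.prod_const, Finset.card_univ,
      Fintype.card_fin]
    rw [Fin.sum_univ_eq_sum_range (fun j => 2 ^ j) (n + 1), Nat.geomSum_eq le_rfl]
    simp
  rw [h, Fintype.card_bool, pow_succ]
  omega

lemma card_wins_eq (hn : 0 < n) (A : Strategy n) (q : ℕ) :
    (Finset.univ.filter fun P : Param n => Wins P A q).card =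
      (Finset.univ.filter fun M : Model n => ModelWins M A q).card :=
  Finset.card_equiv (paramEquiv hn) fun P => by
    simp only [Finset.mem_filter, Finset.mem_univ, true_and, modelWins_paramEquiv]

/-- A union bound for the success probability. -/
lemma wins_ratio_le {m K q D : ℕ} {κ δ : ℝ} (hm : 0 < m) (hmn : m < n) (hK : K < 2 * 2 ^ n)
    (hqK : 2 * q ≤ K) (A : Strategy n) (hD : D + (2 * q + 1) ≤ Fintype.card (Names n))
    (hD0 : 0 < D) (hκ0 : 0 ≤ κ)
    (hκ : ∀ t ≤ 2 * q, (Fintype.card (Names n) : ℝ) ^ t ≤ κ * (D : ℝ) ^ t) (hδ0 : 0 ≤ δ)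
    (hδ : ∀ k < q, ∀ f : List Bool → Names n × Fin 3,
      ((Finset.univ.filter (SpoilEvent m K A k f)).card : ℝ) ≤ δ * Fintype.card (Shape n)) :
    ((Finset.univ.filter fun P : Param n => Wins P A q).card : ℝ)
        / ((Finset.univ : Finset (Param n)).card : ℝ) ≤ q * (κ * (4 * 2 ^ n / D + δ)) := by
  have hn : 0 < n := by omega
  have h := card_modelWins_le hm hmn hK hqK A hD hD0 hκ0 hκ hδ0 hδ
  rw [card_wins_eq hn, Finset.card_univ, Fintype.card_congr (paramEquiv hn)]
  have hN : (Fintype.card (Node n) : ℝ) ≤ 4 * 2 ^ n := by exact_mod_cast card_node_le (n := n)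
  have h0 : (q : ℝ) * (κ * (Fintype.card (Node n) / D + δ)) ≤ q * (κ * (4 * 2 ^ n / D + δ)) := by
    refine mul_le_mul_of_nonneg_left (mul_le_mul_of_nonneg_left ?_ hκ0) (Nat.cast_nonneg _)
    exact add_le_add (div_le_div_of_nonneg_right hN (Nat.cast_nonneg _)) le_rfl
  refine div_le_of_le_mul₀ (Nat.cast_nonneg _) (by positivity) (h.trans ?_)
  exact mul_le_mul_of_nonneg_right h0 (Nat.cast_nonneg _)

lemma pow_le_mul_sub_pow {N a : ℝ} {t : ℕ} (hN : 0 < N) (haN : a ≤ N)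
    (h : 5 * (t * a) ≤ N) : N ^ t ≤ 5 / 4 * (N - a) ^ t := by
  have h1 := one_add_mul_le_pow (a := -(a / N)) (by
    have : a / N ≤ 1 := (div_le_one hN).2 haN
    linarith) t
  have h2 : 4 / 5 ≤ (1 + -(a / N)) ^ t := by
    have : (t : ℝ) * (a / N) ≤ 1 / 5 := by
      rw [← mul_div_assoc, div_le_div_iff₀ hN (by norm_num)]; linarith
    linarith
  have h3 : N - a = N * (1 + -(a / N)) := by field_simp; ring
  rw [h3, mul_pow]
  have h4 : 0 < N ^ t := by positivity
  nlinarith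

lemma guess_bound_le {Q q D : ℝ} (hQ : 4 ≤ Q) (hqQ : q ≤ Q) (hD : Q ^ 12 / 2 ≤ D) :
    q * (5 / 4 * (4 * Q ^ 6 / D)) ≤ 1 / 10 / Q := by
  have hQ0 : 0 < Q := by linarith
  have hD0 : 0 < D := lt_of_lt_of_le (by positivity) hD
  calc q * (5 / 4 * (4 * Q ^ 6 / D)) ≤ Q * (5 / 4 * (4 * Q ^ 6 / (Q ^ 12 / 2))) := by gcongr
    _ = 10 / Q ^ 4 / Q := by field_simp; norm_num
    _ ≤ 10 / 4 ^ 4 / Q := by gcongr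
    _ ≤ 1 / 10 / Q := div_le_div_of_nonneg_right (by norm_num) hQ0.le

lemma spoil_bound_le {Q q H M : ℝ} (hQ : 32 ≤ Q) (hq0 : 0 ≤ q) (hqQ : q ≤ Q) (hH : Q ^ 2 ≤ H)
    (hH' : H ≤ 2 * Q ^ 2) (hM : Q ^ 6 / 2 ≤ M) :
    q * (5 / 4 * (2 * (1 / H + 2 * q * (2 * H + (4 * q + 1)) / M))) ≤ 39 / 10 / Q := by
  have hQ0 : 0 < Q := by linarith
  have hH0 : 0 < H := lt_of_lt_of_le (by positivity) hH
  have hM0 : 0 < M := lt_of_lt_of_le (by positivity) hM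
  calc q * (5 / 4 * (2 * (1 / H + 2 * q * (2 * H + (4 * q + 1)) / M)))
      ≤ Q * (5 / 4 * (2 * (1 / Q ^ 2 +
          2 * Q * (2 * (2 * Q ^ 2) + (4 * Q + 1)) / (Q ^ 6 / 2)))) := by gcongr
    _ = (5 / 2 + 40 / Q + 40 / Q ^ 2 + 10 / Q ^ 3) / Q := by field_simp; ring
    _ ≤ (5 / 2 + 40 / 32 + 40 / 32 ^ 2 + 10 / 32 ^ 3) / Q := by gcongr
    _ ≤ 39 / 10 / Q := by gcongr; norm_num

/-- The lower bound in terms of `Q = 2 ^ (n / 6)`. -/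
lemma wins_ratio_le_four_div {q : ℕ} {Q : ℝ} (hn : 13 ≤ n) (hQ0 : 0 < Q) (hQ : Q ^ 6 = 2 ^ n)
    (hq : (q : ℝ) ≤ Q) (A : Strategy n) :
    ((Finset.univ.filter fun P : Param n => Wins P A q).card : ℝ)
        / ((Finset.univ : Finset (Param n)).card : ℝ) ≤ 4 / Q := by
  have hq0 : (0 : ℝ) ≤ q := Nat.cast_nonneg q
  have hQ4 : 4 ≤ Q := by
    refine le_of_pow_le_pow_left₀ (n := 6) (by norm_num) hQ0.le ?_
    rw [hQ]
    calc (4 : ℝ) ^ 6 = 2 ^ 12 := by norm_num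
      _ ≤ 2 ^ n := pow_le_pow_right₀ (by norm_num) (by omega)
  have hN : (Fintype.card (Names n) : ℝ) = Q ^ 12 := by
    rw [show Q ^ 12 = (Q ^ 6) ^ 2 by ring, hQ, ← pow_mul]
    simp [mul_comm]
  have hQ12 : 1024 * Q ^ 2 ≤ Q ^ 12 := by
    have : (4 : ℝ) ^ 10 ≤ Q ^ 10 := by gcongr
    rw [show Q ^ 12 = Q ^ 10 * Q ^ 2 by ring]
    gcongr
    linarith
  have hQ6 : 256 * Q ^ 2 ≤ Q ^ 6 := by
    have : (4 : ℝ) ^ 4 ≤ Q ^ 4 := by gcongr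
    rw [show Q ^ 6 = Q ^ 4 * Q ^ 2 by ring]
    gcongr
    linarith
  have hQ2 : 4 * Q ≤ Q ^ 2 := by nlinarith
  have hlt : 2 * q + 1 < Fintype.card (Names n) := by
    rify; rw [hN]; linarith
  obtain ⟨D, hD⟩ : ∃ D, D + (2 * q + 1) = Fintype.card (Names n) :=
    ⟨_, Nat.sub_add_cancel hlt.le⟩
  have hDr : (D : ℝ) = Q ^ 12 - (2 * q + 1) := by
    rw [← hN, ← hD]; push_cast; ring
  have hD2 : Q ^ 12 / 2 ≤ D := by rw [hDr]; linarith
  have hκ : ∀ t ≤ 2 * q, (Fintype.card (Names n) : ℝ) ^ t ≤ 5 / 4 * (D : ℝ) ^ t := by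
    intro t ht
    have ht' : (t : ℝ) ≤ 2 * q := by exact_mod_cast ht
    have ht2 : (t : ℝ) * (2 * q + 1) ≤ 2 * Q * (2 * Q + 1) := by gcongr; linarith
    rw [hN, hDr]
    exact pow_le_mul_sub_pow (by positivity) (by linarith) (by linarith)
  have hK : 2 * q < 2 * 2 ^ n := by
    rify; rw [← hQ]; linarith
  by_cases hqn : q < n
  · have h := wins_ratio_le (m := 1) (K := 2 * q) (D := D) (κ := 5 / 4) (δ := 0) one_pos (by omega)
      hK le_rfl A hD.le (by omega) (by norm_num) hκ le_rfl fun k hk f => by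
        have he : Finset.univ.filter (SpoilEvent 1 (2 * q) A k f) = ∅ :=
          Finset.filter_eq_empty_iff.2 fun ω _ hω => hω.2 <| good_of_short (by omega) fun w hw =>
            (run_length_le f A (k + 1) w hw).trans_lt (by omega)
        rw [he, zero_mul, Finset.card_empty, Nat.cast_zero]
    refine h.trans ?_
    rw [add_zero, ← hQ]
    refine (guess_bound_le hQ4 hq hD2).trans ?_
    gcongr
    norm_num
  · have hn30 : 30 ≤ n := by
      by_contra hlt
      have h6 : n ^ 6 ≤ 2 ^ n := by
        have : ((n : ℝ)) ^ 6 ≤ 2 ^ n := by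
          rw [← hQ]
          have : (n : ℝ) ≤ q := by exact_mod_cast not_lt.1 hqn
          gcongr
          linarith
        exact_mod_cast this
      have h29 : n ≤ 29 := by omega
      clear * - hn h6 h29
      interval_cases n <;> norm_num at h6
    have hQ32 : 32 ≤ Q := by
      refine le_of_pow_le_pow_left₀ (n := 6) (by norm_num) hQ0.le ?_
      rw [hQ]
      calc (32 : ℝ) ^ 6 = 2 ^ 30 := by norm_num
        _ ≤ 2 ^ n := pow_le_pow_right₀ (by norm_num) hn30
    have hH : Q ^ 2 ≤ 2 ^ (n / 3 + 1) := by
      refine le_of_pow_le_pow_left₀ (n := 3) (by norm_num) (by positivity) ?_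
      rw [← pow_mul, hQ, ← pow_mul]
      exact pow_le_pow_right₀ (by norm_num) (by omega)
    have hH' : (2 : ℝ) ^ (n / 3 + 1) ≤ 2 * Q ^ 2 := by
      rw [pow_succ, mul_comm]
      refine mul_le_mul_of_nonneg_left ?_ (by norm_num)
      refine le_of_pow_le_pow_left₀ (n := 3) (by norm_num) (by positivity) ?_
      rw [← pow_mul, ← pow_mul, hQ]
      exact pow_le_pow_right₀ (by norm_num) (by omega)
    have hMlt : 2 * q + 3 < 2 ^ n := by
      rify; rw [← hQ]; linarith
    obtain ⟨M, hM⟩ : ∃ M, M + (2 * q + 3) = 2 ^ n := ⟨_, Nat.sub_add_cancel hMlt.le⟩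
    have hMr : (M : ℝ) = Q ^ 6 - (2 * q + 3) := by
      rw [hQ]
      have := congrArg (Nat.cast (R := ℝ)) hM
      push_cast at this
      linarith
    have h := wins_ratio_le (m := n - (n / 3 + 1)) (K := 2 * q) (D := D) (κ := 5 / 4) (by omega)
      (by omega) hK le_rfl A hD.le (by omega) (by norm_num) hκ (by positivity) fun k hk f =>
        card_spoilEvent_shape_le (h := n / 3 + 1) (M := M) (by omega) (by omega) (by omega)
          (by omega) (by omega) A hk f
    refine h.trans ?_
    rw [mul_add, mul_add, ← hQ]
    refine (add_le_add (guess_bound_le hQ4 hq hD2) (spoil_bound_le hQ32 hq0 hq hH hH' ?_)).trans ?_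
    · rw [hMr]; linarith
    · rw [← add_div]
      norm_num

/-- Classical lower bound for the glued-trees traversal problem: any classical
algorithm making at most `2^{n/6}` queries to the oracle finds the EXIT with
probability at most `4 · 2^{−n/6}`, the probability being uniform over the random
alternating cycle, the random naming of vertices by distinct `2n`-bit strings (with
ENTRANCE named `0`), and the random `9`-coloring of the edges. -/
theorem classical_lower_bound (n q : ℕ) (hq : (q : ℝ) ≤ (2 : ℝ) ^ ((n : ℝ) / 6))
    (A : Strategy n) :
    ((Finset.univ.filter fun P : Param n => Wins P A q).card : ℝ)
        / ((Finset.univ : Finset (Param n)).card : ℝ)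
      ≤ 4 * (2 : ℝ) ^ (-(n : ℝ) / 6) := by
  have hinv : 4 * (2 : ℝ) ^ (-(n : ℝ) / 6) = 4 / (2 : ℝ) ^ ((n : ℝ) / 6) := by
    rw [neg_div, Real.rpow_neg (by norm_num), ← div_eq_mul_inv]
  rw [hinv]
  by_cases hn : 13 ≤ n
  · refine wins_ratio_le_four_div hn (by positivity) ?_ hq A
    rw [← Real.rpow_natCast, ← Real.rpow_mul (by norm_num), Nat.cast_ofNat,
      div_mul_cancel₀ _ (by norm_num), Real.rpow_natCast]
  · have hQ : (2 : ℝ) ^ ((n : ℝ) / 6) ≤ 4 := by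
      have hn' : (n : ℝ) ≤ 12 := by exact_mod_cast Nat.le_of_lt_succ (not_le.1 hn)
      calc (2 : ℝ) ^ ((n : ℝ) / 6) ≤ (2 : ℝ) ^ (2 : ℝ) :=
            Real.rpow_le_rpow_of_exponent_le (by norm_num) (by linarith)
        _ = 4 := by norm_num
    refine (div_le_one_of_le₀ ?_ (Nat.cast_nonneg _)).trans ((one_le_div (by positivity)).2 hQ)
    exact Nat.cast_le.2 (Finset.card_le_card (Finset.filter_subset _ _))

end GluedTreesLowerBound
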